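/- arXiv:1811.12293 — 5 statements merged into one kernel-verified Lean document; each statement's English description precedes it below -/
import Mathlib

section
/- Let f, g : ℝ → ℝ be n-times continuously differentiable near t₀ with f'(t₀) ≠ 0, and let h be a function defined near x₀ = f(t₀) satisfying h(f(t)) = g(t) for all t near t₀ (so y = h(x) is the function given parametrically by x = f(t), y = g(t)). Then for every n ≥ 1, dⁿy/dxⁿ at x₀ equals the sum over k from 0 to n−1 of (−1)ᵏ · [f'(t₀)]^(−n−k) · P_{n,k}(t₀). -/
open scoped Classical in
/-- `pSum f g n k t` is `P_{n,k}(t)`: the sum over all set partitions of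
`{1, …, n+k}` (encoded as `Fin (n + k)`, the element `1` corresponding to the
member of value `0`) into `k+1` blocks in which no block other than the block
containing `1` is a singleton, of the products
`g^(b₁)(t) · f^(b₂)(t) ⋯ f^(b_{k+1})(t)`, where `b₁` is the size of the block
containing `1` and `b₂, …, b_{k+1}` are the sizes of the other blocks.
It is `0` when `k < 0` or when no such partition exists (empty sum). -/
noncomputable def pSum (f g : ℝ → ℝ) (n : ℕ) (k : ℤ) (t : ℝ) : ℝ :=
  if k < 0 then 0 else
    ∑ part ∈ Finset.univ.filter (fun part : Finset (Finset (Fin (n + k.toNat))) =>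
        (∀ B ∈ part, B.Nonempty) ∧
        (∀ x, ∃! B, B ∈ part ∧ x ∈ B) ∧
        part.card = k.toNat + 1 ∧
        ∀ B ∈ part, B.card = 1 → ∃ x ∈ B, (x : ℕ) = 0),
      ∏ B ∈ part,
        if ∃ x ∈ B, (x : ℕ) = 0 then iteratedDeriv B.card g t
        else iteratedDeriv B.card f t

structure PValid {α : Type*} [DecidableEq α] (a : α) (s : Finset α) (k : ℕ)
    (p : Finset (Finset α)) : Prop where
  sub : ∀ B ∈ p, B ⊆ s
  ne : ∀ B ∈ p, B.Nonempty
  ex : ∀ x ∈ s, ∃ B ∈ p, x ∈ B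
  un : ∀ B ∈ p, ∀ C ∈ p, ∀ x, x ∈ B → x ∈ C → B = C
  cd : p.card = k + 1
  sg : ∀ B ∈ p, B.card = 1 → a ∈ B

open scoped Classical in
noncomputable def PV {α : Type*} [DecidableEq α] (a : α) (s : Finset α) (k : ℕ) :
    Finset (Finset (Finset α)) :=
  s.powerset.powerset.filter (PValid a s k)

theorem mem_PV {α : Type*} [DecidableEq α] {a : α} {s : Finset α} {k : ℕ}
    {p : Finset (Finset α)} : p ∈ PV a s k ↔ PValid a s k p := by
  unfold PV
  simp only [Finset.mem_filter, Finset.mem_powerset, and_iff_right_iff_imp]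
  intro h B hB
  exact Finset.mem_powerset.2 (h.sub B hB)

theorem PValid.add1 {α : Type*} [DecidableEq α] {a m : α} {s : Finset α} {k : ℕ}
    (hm : m ∉ s) {p : Finset (Finset α)} (h : PValid a s k p) {B : Finset α} (hB : B ∈ p) :
    insert m B ∉ p.erase B ∧
    PValid a (insert m s) k (insert (insert m B) (p.erase B)) ∧
      ∀ x ∈ s.erase a, {m, x} ∉ insert (insert m B) (p.erase B) := by
  have hmp : ∀ C ∈ p, m ∉ C := fun C hC hmC => hm (h.sub C hC hmC)
  have hnot : insert m B ∉ p.erase B := by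
    intro hc
    exact hmp _ (Finset.mem_of_mem_erase hc) (Finset.mem_insert_self _ _)
  have hBn := h.ne B hB
  refine ⟨hnot, ⟨?_, ?_, ?_, ?_, ?_, ?_⟩, ?_⟩
  · intro C hC
    have := h.sub
    have := h.sub B hB
    grind
  · have := h.ne
    grind
  · intro y hy
    rcases Finset.mem_insert.1 hy with rfl | hy
    · exact ⟨insert y B, by simp, by simp⟩
    obtain ⟨C, hC, hyC⟩ := h.ex y hy
    by_cases hCB : C = B
    · exact ⟨insert m B, by simp, by subst hCB; simp [hyC]⟩
    · exact ⟨C, by simp [hCB, hC], hyC⟩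
  · have := h.un
    have := h.sub
    intro C hC D hD x hx hx'
    grind
  · rw [Finset.card_insert_of_notMem hnot, Finset.card_erase_add_one hB, h.cd]
  · intro C hC hC1
    rcases Finset.mem_insert.1 hC with rfl | hC
    · rw [Finset.card_insert_of_notMem (hmp _ hB)] at hC1
      have := hBn.card_pos
      omega
    · exact h.sg C (Finset.mem_of_mem_erase hC) hC1
  · intro x hx hc
    have hxs := Finset.mem_of_mem_erase hx
    have hxa := Finset.ne_of_mem_erase hx
    rcases Finset.mem_insert.1 hc with hc | hc
    · have hBx : B = {x} := by
        have : m ∉ B := hmp B hB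
        have : m ≠ x := by rintro rfl; exact hm hxs
        ext y
        have := Finset.ext_iff.1 hc y
        have := Finset.ext_iff.1 hc x
        grind
      have := h.sg B hB (by simp [hBx])
      rw [hBx] at this
      exact hxa (Finset.mem_singleton.1 this).symm
    · exact hmp _ (Finset.mem_of_mem_erase hc) (Finset.mem_insert_self _ _)

theorem PValid.add2 {α : Type*} [DecidableEq α] {a m x : α} {s : Finset α} {k : ℕ}
    (hm : m ∉ s) (hx : x ∈ s) {p : Finset (Finset α)} (h : PValid a (s.erase x) k p) :
    {m, x} ∉ p ∧ PValid a (insert m s) (k+1) (insert {m, x} p) := by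
  have hsub : ∀ C ∈ p, ∀ y ∈ C, y ∈ s ∧ y ≠ x := by
    intro C hC y hy
    have := h.sub C hC hy
    grind
  have hmx : m ≠ x := by rintro rfl; exact hm hx
  have hnot : {m, x} ∉ p := fun hc => (hsub _ hc x (by simp)).2 rfl
  refine ⟨hnot, ⟨?_, ?_, ?_, ?_, ?_, ?_⟩⟩
  · intro C hC y hy
    grind
  · have := h.ne
    grind
  · have := h.ex
    intro y hy
    by_cases h1 : y = m
    · exact ⟨{m,x}, by simp, by simp [h1]⟩
    by_cases h2 : y = x
    · exact ⟨{m,x}, by simp, by simp [h2]⟩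
    obtain ⟨C, hC, hyC⟩ := h.ex y (by grind)
    exact ⟨C, by simp [hC], hyC⟩
  · have := h.un
    intro C hC D hD y hy hy'
    grind
  · rw [Finset.card_insert_of_notMem hnot, h.cd]
  · intro C hC hC1
    rcases Finset.mem_insert.1 hC with rfl | hC
    · rw [Finset.card_pair hmx] at hC1
      omega
    · exact h.sg C hC hC1

theorem PValid.rem2 {α : Type*} [DecidableEq α] {a m x : α} {s : Finset α} {k : ℕ}
    (hm : m ∉ s) (ha : a ∈ s) (hx : x ∈ s.erase a) {q : Finset (Finset α)}
    (h : PValid a (insert m s) k q) (hq : {m, x} ∈ q) :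
    ∃ j, k = j + 1 ∧ PValid a (s.erase x) j (q.erase {m, x}) := by
  have hxs := Finset.mem_of_mem_erase hx
  have hxa := Finset.ne_of_mem_erase hx
  have hma : m ≠ a := by rintro rfl; exact hm ha
  obtain ⟨A, hA, haA⟩ := h.ex a (Finset.mem_insert_of_mem ha)
  have hAne : A ≠ {m, x} := by
    rintro rfl
    grind
  have hc : 1 < q.card := Finset.one_lt_card.2 ⟨A, hA, _, hq, hAne⟩
  have hcd := h.cd
  have hdis : ∀ C ∈ q.erase {m,x}, ∀ y ∈ C, y ≠ m ∧ y ≠ x := by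
    intro C hC y hy
    have h1 := h.un C (Finset.mem_of_mem_erase hC) _ hq y hy
    have h2 := Finset.ne_of_mem_erase hC
    constructor
    · rintro rfl; exact h2 (h1 (by simp))
    · rintro rfl; exact h2 (h1 (by simp))
  refine ⟨k - 1, by omega, ?_, ?_, ?_, ?_, ?_, ?_⟩
  · intro C hC y hy
    have := h.sub C (Finset.mem_of_mem_erase hC) hy
    have := hdis C hC y hy
    grind
  · exact fun C hC => h.ne C (Finset.mem_of_mem_erase hC)
  · intro y hy
    obtain ⟨C, hC, hyC⟩ := h.ex y (by grind)
    refine ⟨C, ?_, hyC⟩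
    refine Finset.mem_erase.2 ⟨?_, hC⟩
    rintro rfl
    grind
  · exact fun C hC D hD => h.un C (Finset.mem_of_mem_erase hC) D (Finset.mem_of_mem_erase hD)
  · rw [Finset.card_erase_of_mem hq]; omega
  · exact fun C hC => h.sg C (Finset.mem_of_mem_erase hC)

theorem PValid.rem1 {α : Type*} [DecidableEq α] {a m : α} {s : Finset α} {k : ℕ}
    (hm : m ∉ s) (ha : a ∈ s) {q : Finset (Finset α)}
    (h : PValid a (insert m s) k q) (hq : ∀ x ∈ s.erase a, {m, x} ∉ q)
    {C : Finset α} (hC : C ∈ q) (hmC : m ∈ C) :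
    C.erase m ∉ q ∧ PValid a s k (insert (C.erase m) (q.erase C)) := by
  have hma : m ≠ a := by rintro rfl; exact hm ha
  have hCc : C.card ≠ 1 := by
    intro hc
    obtain ⟨y, rfl⟩ := Finset.card_eq_one.1 hc
    have := h.sg _ hC hc
    grind
  have hne : (C.erase m).Nonempty := by
    rw [← Finset.card_pos, Finset.card_erase_of_mem hmC]
    have := Finset.card_pos.2 (h.ne C hC)
    omega
  have hnot : C.erase m ∉ q := by
    intro hc
    obtain ⟨y, hy⟩ := hne
    have := h.un _ hc C hC y hy (Finset.mem_of_mem_erase hy)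
    have h2 : m ∈ C.erase m := by rw [this]; exact hmC
    simp at h2
  have hmq : ∀ D ∈ q.erase C, m ∉ D := by
    intro D hD hmD
    exact (Finset.ne_of_mem_erase hD) (h.un D (Finset.mem_of_mem_erase hD) C hC m hmD hmC)
  refine ⟨hnot, ?_, ?_, ?_, ?_, ?_, ?_⟩
  · intro D hD y hy
    rcases Finset.mem_insert.1 hD with rfl | hD
    · have := h.sub C hC (Finset.mem_of_mem_erase hy)
      grind
    · have := h.sub D (Finset.mem_of_mem_erase hD) hy
      have := hmq D hD
      grind
  · have := h.ne
    grind
  · intro y hy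
    obtain ⟨D, hD, hyD⟩ := h.ex y (Finset.mem_insert_of_mem hy)
    by_cases hDC : D = C
    · refine ⟨C.erase m, by simp, ?_⟩
      grind
    · exact ⟨D, by grind, hyD⟩
  · have := h.un
    intro D hD E hE y hy hy'
    grind
  · rw [Finset.card_insert_of_notMem (fun hc => hnot (Finset.mem_of_mem_erase hc)),
      Finset.card_erase_add_one hC, h.cd]
  · intro D hD hD1
    rcases Finset.mem_insert.1 hD with rfl | hD
    · obtain ⟨x, hx⟩ := Finset.card_eq_one.1 hD1
      by_contra hcon
      have hCx : C = {m, x} := by rw [← hx, Finset.insert_erase hmC]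
      refine hq x ?_ (hCx ▸ hC)
      have hxC : x ∈ C.erase m := by rw [hx]; simp
      have := h.sub C hC (Finset.mem_of_mem_erase hxC)
      grind
    · exact h.sg D (Finset.mem_of_mem_erase hD) hD1

/-- weight -/
noncomputable def PW {α : Type*} [DecidableEq α] (a : α) (F G : ℕ → ℝ) (B : Finset α) : ℝ :=
  if a ∈ B then G B.card else F B.card

noncomputable def PQ {α : Type*} [DecidableEq α] (F G : ℕ → ℝ) (a : α) (s : Finset α)
    (k : ℕ) : ℝ := ∑ p ∈ PV a s k, ∏ B ∈ p, PW a F G B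

theorem PQ_insert {α : Type*} [DecidableEq α] (F G : ℕ → ℝ) {a m : α} {s : Finset α}
    (hm : m ∉ s) (ha : a ∈ s) (k : ℕ) :
    PQ F G a (insert m s) k =
      (∑ p ∈ PV a s k, ∑ B ∈ p, (∏ C ∈ p.erase B, PW a F G C) * PW a F G (insert m B)) +
      (match k with
        | 0 => 0
        | j + 1 => ∑ x ∈ s.erase a, F 2 * PQ F G a (s.erase x) j) := by
  classical
  have hma : m ≠ a := by rintro rfl; exact hm ha
  unfold PQ
  rw [← Finset.sum_filter_not_add_sum_filter _ (fun q => ∃ x ∈ s.erase a, {m, x} ∈ q)]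
  congr 1
  · symm
    rw [Finset.sum_sigma']
    refine Finset.sum_bij (fun z _ => insert (insert m z.2) (z.1.erase z.2)) ?_ ?_ ?_ ?_
    · rintro ⟨p, B⟩ hz
      rw [Finset.mem_sigma, mem_PV] at hz
      have := hz.1.add1 hm hz.2
      rw [Finset.mem_filter, mem_PV]
      refine ⟨this.2.1, ?_⟩
      push Not
      exact this.2.2
    · rintro ⟨p, B⟩ hz ⟨p', B'⟩ hz' heq
      rw [Finset.mem_sigma, mem_PV] at hz hz'
      dsimp only at hz hz' heq
      have h1 := hz.1.add1 hm hz.2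
      have h1' := hz'.1.add1 hm hz'.2
      have hBB : insert m B = insert m B' :=
        h1.2.1.un _ (by simp) _ (by rw [heq]; simp) m (by simp) (by simp)
      have hmB : m ∉ B := fun hc => hm (hz.1.sub B hz.2 hc)
      have hmB' : m ∉ B' := fun hc => hm (hz'.1.sub B' hz'.2 hc)
      have hB : B = B' := by
        rw [← Finset.erase_insert hmB, hBB, Finset.erase_insert hmB']
      subst hB
      have hp : p.erase B = p'.erase B := by
        rw [← Finset.erase_insert h1.1, heq, Finset.erase_insert h1'.1]
      have : p = p' := by
        rw [← Finset.insert_erase hz.2, hp, Finset.insert_erase hz'.2]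
      rw [this]
    · intro q hq
      rw [Finset.mem_filter, mem_PV] at hq
      obtain ⟨hq, hq'⟩ := hq
      push Not at hq'
      obtain ⟨C, hC, hmC⟩ := hq.ex m (by simp)
      obtain ⟨h1, h2⟩ := hq.rem1 hm ha hq' hC hmC
      refine ⟨⟨insert (C.erase m) (q.erase C), C.erase m⟩, ?_, ?_⟩
      · rw [Finset.mem_sigma, mem_PV]
        exact ⟨h2, by simp⟩
      · dsimp only
        rw [Finset.insert_erase hmC, Finset.erase_insert, Finset.insert_erase hC]
        exact fun hc => h1 (Finset.mem_of_mem_erase hc)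
    · rintro ⟨p, B⟩ hz
      rw [Finset.mem_sigma, mem_PV] at hz
      have := hz.1.add1 hm hz.2
      dsimp only
      rw [Finset.prod_insert this.1, mul_comm]
  · rcases k with _ | j
    · dsimp only
      refine Finset.sum_eq_zero ?_
      intro q hq
      rw [Finset.mem_filter, mem_PV] at hq
      obtain ⟨hq, x, hx, hxq⟩ := hq
      obtain ⟨j, hj, _⟩ := hq.rem2 hm ha hx hxq
      omega
    · dsimp only
      simp_rw [Finset.mul_sum]
      symm
      rw [Finset.sum_sigma']
      refine Finset.sum_bij (fun z _ => insert {m, z.1} z.2) ?_ ?_ ?_ ?_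
      · rintro ⟨x, p⟩ hz
        rw [Finset.mem_sigma, mem_PV] at hz
        have := hz.2.add2 hm (Finset.mem_of_mem_erase hz.1)
        rw [Finset.mem_filter, mem_PV]
        exact ⟨this.2, x, hz.1, by simp⟩
      · rintro ⟨x, p⟩ hz ⟨x', p'⟩ hz' heq
        rw [Finset.mem_sigma, mem_PV] at hz hz'
        dsimp only at hz hz' heq
        have h1 := hz.2.add2 hm (Finset.mem_of_mem_erase hz.1)
        have h1' := hz'.2.add2 hm (Finset.mem_of_mem_erase hz'.1)
        have hBB : ({m, x} : Finset α) = {m, x'} :=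
          h1.2.un _ (by simp) _ (by rw [heq]; simp) m (by simp) (by simp)
        have hmx : m ≠ x := by rintro rfl; exact hm (Finset.mem_of_mem_erase hz.1)
        have hxx : x = x' := by
          have : x ∈ ({m, x'} : Finset α) := by rw [← hBB]; simp
          grind
        subst hxx
        have : p = p' := by
          rw [← Finset.erase_insert h1.1, heq, Finset.erase_insert h1'.1]
        rw [this]
      · intro q hq
        rw [Finset.mem_filter, mem_PV] at hq
        obtain ⟨hq, x, hx, hxq⟩ := hq
        obtain ⟨i, hi, h2⟩ := hq.rem2 hm ha hx hxq
        obtain rfl : j = i := by omega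
        exact ⟨⟨x, q.erase {m, x}⟩, by rw [Finset.mem_sigma, mem_PV]; exact ⟨hx, h2⟩,
          Finset.insert_erase hxq⟩
      · rintro ⟨x, p⟩ hz
        rw [Finset.mem_sigma, mem_PV] at hz
        have h1 := hz.2.add2 hm (Finset.mem_of_mem_erase hz.1)
        have hmx : m ≠ x := by rintro rfl; exact hm (Finset.mem_of_mem_erase hz.1)
        have hxa := Finset.ne_of_mem_erase hz.1
        dsimp only at *
        rw [Finset.prod_insert h1.1]
        congr 1
        rw [PW, if_neg (by grind), Finset.card_pair hmx]

theorem PValid.image {α β : Type*} [DecidableEq α] [DecidableEq β] {e : α → β}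
    (he : Function.Injective e) {a : α} {s : Finset α} {k : ℕ} {p : Finset (Finset α)} 
    (h : PValid a s k p) : PValid (e a) (s.image e) k (p.image (Finset.image e)) := by
  have hi := Finset.image_injective he
  refine ⟨?_, ?_, ?_, ?_, ?_, ?_⟩
  · simp only [Finset.forall_mem_image]
    exact fun B hB => Finset.image_subset_image (h.sub B hB)
  · simp only [Finset.forall_mem_image]
    exact fun B hB => (h.ne B hB).image _
  · simp only [Finset.forall_mem_image]
    intro x hx
    obtain ⟨B, hB, hxB⟩ := h.ex x hx
    exact ⟨_, Finset.mem_image_of_mem _ hB, Finset.mem_image_of_mem _ hxB⟩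
  · simp only [Finset.forall_mem_image]
    intro B hB C hC x hx hx'
    rw [he.mem_finset_image] at hx'
    rw [h.un B hB C hC x hx hx']
  · rw [Finset.card_image_of_injective _ hi, h.cd]
  · simp only [Finset.forall_mem_image]
    intro B hB hc
    rw [Finset.card_image_of_injective _ he] at hc
    exact Finset.mem_image_of_mem _ (h.sg B hB hc)

theorem PValid.of_image {α β : Type*} [DecidableEq α] [DecidableEq β] {e : α → β}
    (he : Function.Injective e) {a : α} {s : Finset α} {k : ℕ} {p : Finset (Finset α)} 
    (h : PValid (e a) (s.image e) k (p.image (Finset.image e))) : PValid a s k p := by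
  have hi := Finset.image_injective he
  obtain ⟨h1, h2, h3, h4, h5, h6⟩ := h
  simp only [Finset.forall_mem_image] at h1 h2 h3 h4 h6
  refine ⟨?_, ?_, ?_, ?_, ?_, ?_⟩
  · exact fun B hB => (Finset.image_subset_image_iff he).1 (h1 hB)
  · exact fun B hB => Finset.image_nonempty.1 (h2 hB)
  · intro x hx
    obtain ⟨B, hB, hxB⟩ := h3 hx
    obtain ⟨C, hC, rfl⟩ := Finset.mem_image.1 hB
    exact ⟨C, hC, (he.mem_finset_image).1 hxB⟩
  · intro B hB C hC x hx hx'
    exact hi (h4 hB hC hx (Finset.mem_image_of_mem _ hx'))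
  · rw [← h5, Finset.card_image_of_injective _ hi]
  · intro B hB hc
    have := h6 hB (by rw [Finset.card_image_of_injective _ he, hc])
    exact (he.mem_finset_image).1 this

theorem PQ_image {α β : Type*} [DecidableEq α] [DecidableEq β] (F G : ℕ → ℝ) {e : α → β}
    (he : Function.Injective e) (a : α) (s : Finset α) (k : ℕ) :
    PQ F G (e a) (s.image e) k = PQ F G a s k := by
  have hi := Finset.image_injective he
  unfold PQ
  symm
  refine Finset.sum_bij (fun p _ => p.image (Finset.image e)) ?_ ?_ ?_ ?_
  · intro p hp
    rw [mem_PV] at hp ⊢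
    exact hp.image he
  · intro p _ q _ h
    exact Finset.image_injective hi h
  · intro q hq
    rw [mem_PV] at hq
    have : ∃ p : Finset (Finset α), p.image (Finset.image e) = q := by
      have : (q : Set (Finset β)) ⊆ Set.range (Finset.image e) := by
        intro B hB
        obtain ⟨C, _, hC⟩ := Finset.subset_image_iff.1 (hq.sub B hB)
        exact ⟨C, hC⟩
      obtain ⟨p, hp⟩ := Finset.subset_set_image_iff.1 (by simpa using this : (q : Set (Finset β)) ⊆ (Finset.image e) '' Set.univ)
      exact ⟨p, hp.2⟩
    obtain ⟨p, rfl⟩ := this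
    exact ⟨p, mem_PV.2 (hq.of_image he), rfl⟩
  · intro p _
    rw [Finset.prod_image (fun _ _ _ _ h => hi h)]
    refine Finset.prod_congr rfl fun B _ => ?_
    unfold PW
    rw [Finset.card_image_of_injective _ he]
    simp only [he.mem_finset_image]

theorem PValid.sum_card {α : Type*} [DecidableEq α] {a : α} {s : Finset α} {k : ℕ}
    {p : Finset (Finset α)} (h : PValid a s k p) : ∑ B ∈ p, B.card = s.card := by
  have : p.biUnion id = s := by
    ext x
    simp only [Finset.mem_biUnion, id]
    constructor
    · rintro ⟨B, hB, hx⟩; exact h.sub B hB hx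
    · exact h.ex x
  rw [← this, Finset.card_biUnion]
  · rfl
  · intro B hB C hC hBC
    refine Finset.disjoint_left.2 ?_
    intro x hx hx'
    exact hBC (h.un B hB C hC x hx hx')

theorem PValid.card_le {α : Type*} [DecidableEq α] {a : α} {s : Finset α} {k n : ℕ}
    {p : Finset (Finset α)} (h : PValid a s k p) (hs : s.card = n + k) {B : Finset α}
    (hB : B ∈ p) : B.card ≤ n := by
  have h1 := h.sum_card
  rw [← Finset.add_sum_erase _ _ hB] at h1
  have h2 : ∑ C ∈ p.erase B, 1 ≤ ∑ C ∈ p.erase B, C.card :=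
    Finset.sum_le_sum fun C hC => Finset.card_pos.2 (h.ne C (Finset.mem_of_mem_erase hC))
  rw [Finset.sum_const, Finset.card_erase_of_mem hB, h.cd] at h2
  simp at h2
  omega

theorem PQ_zero {α : Type*} [DecidableEq α] (F G : ℕ → ℝ) {a : α} {s : Finset α}
    (ha : a ∈ s) {k : ℕ} (hk : s.card < 2 * k + 1) : PQ F G a s k = 0 := by
  unfold PQ
  refine Finset.sum_eq_zero fun p hp => ?_
  rw [mem_PV] at hp
  exfalso
  obtain ⟨A, hA, haA⟩ := hp.ex a ha
  have h1 := hp.sum_card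
  rw [← Finset.add_sum_erase _ _ hA] at h1
  have h2 : ∑ C ∈ p.erase A, 2 ≤ ∑ C ∈ p.erase A, C.card := by
    refine Finset.sum_le_sum fun C hC => ?_
    have hCp := Finset.mem_of_mem_erase hC
    have h3 := Finset.card_pos.2 (hp.ne C hCp)
    have h4 : C.card ≠ 1 := fun hc =>
      Finset.ne_of_mem_erase hC (hp.un C hCp A hA a (hp.sg C hCp hc) haA)
    omega
  have h3 := Finset.card_pos.2 (hp.ne A hA)
  rw [Finset.sum_const, Finset.card_erase_of_mem hA, hp.cd] at h2
  simp at h2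
  omega

theorem PQ_one (F G : ℕ → ℝ) : PQ F G 0 (Finset.range 1) 0 = G 1 := by
  have : PV 0 (Finset.range 1) 0 = {{{0}}} := by
    ext p
    rw [mem_PV, Finset.mem_singleton]
    constructor
    · intro h
      obtain ⟨B, rfl⟩ := Finset.card_eq_one.1 h.cd
      have h1 := h.sub B (by simp)
      have h2 := h.ne B (by simp)
      rw [Finset.range_one, Finset.subset_singleton_iff] at h1
      rcases h1 with rfl | rfl
      · simp at h2
      · rfl
    · rintro rfl
      constructor <;> simp
  unfold PQ
  rw [this]
  simp [PW]

/-- `P_{n,k}` -/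
noncomputable def PP (f g : ℝ → ℝ) (n k : ℕ) (t : ℝ) : ℝ :=
  PQ (fun j => iteratedDeriv j f t) (fun j => iteratedDeriv j g t) 0 (Finset.range (n + k)) k

theorem PQ_erase (F G : ℕ → ℝ) (N x k : ℕ) (hx : x ∈ (Finset.range (N + 1)).erase 0) :
    PQ F G 0 ((Finset.range (N + 1)).erase x) k = PQ F G 0 (Finset.range N) k := by
  have hx0 : x ≠ 0 := Finset.ne_of_mem_erase hx
  have hxN := Finset.mem_range.1 (Finset.mem_of_mem_erase hx)
  let e : ℕ → ℕ := fun i => if i < x then i else i + 1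
  have he : Function.Injective e := by
    intro i j hij
    simp only [e] at hij
    split_ifs at hij <;> omega
  have h0 : e 0 = 0 := by simp [e]; omega
  have him : (Finset.range N).image e = (Finset.range (N + 1)).erase x := by
    ext i
    simp only [Finset.mem_image, Finset.mem_range, Finset.mem_erase, e]
    constructor
    · rintro ⟨j, hj, rfl⟩
      split_ifs <;> omega
    · intro hi
      by_cases h : i < x
      · exact ⟨i, by omega, by simp [h]⟩
      · exact ⟨i - 1, by omega, by rw [if_neg (by omega)]; omega⟩
  have := PQ_image F G he 0 (Finset.range N) k
  rw [h0, him] at this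
  exact this

/-- correction -/
noncomputable def PE (f g : ℝ → ℝ) (n k : ℕ) (t : ℝ) : ℝ :=
  match k with
  | 0 => 0
  | j + 1 => ((n : ℝ) + j) * iteratedDeriv 2 f t * PP f g n j t

theorem PP_hasDerivAt (f g : ℝ → ℝ) (n k : ℕ) (hn : 1 ≤ n) (t : ℝ)
    (hf : ∀ j ≤ n, HasDerivAt (iteratedDeriv j f) (iteratedDeriv (j + 1) f t) t)
    (hg : ∀ j ≤ n, HasDerivAt (iteratedDeriv j g) (iteratedDeriv (j + 1) g t) t) :
    HasDerivAt (PP f g n k) (PP f g (n + 1) k t - PE f g n k t) t := by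
  have key := PQ_insert (fun j => iteratedDeriv j f t) (fun j => iteratedDeriv j g t)
    (a := 0) (m := n + k) (s := Finset.range (n + k)) (by simp) (by simp; omega) k
  rw [← Finset.range_add_one] at key
  have e1 : PP f g (n + 1) k t = PQ (fun j => iteratedDeriv j f t) (fun j => iteratedDeriv j g t) 0
      (Finset.range (n + k + 1)) k := by
    unfold PP; congr 2; omega
  have e3 : PP f g (n + 1) k t - PE f g n k t = ∑ p ∈ PV 0 (Finset.range (n + k)) k, ∑ B ∈ p,
      (∏ C ∈ p.erase B, PW 0 (fun j => iteratedDeriv j f t) (fun j => iteratedDeriv j g t) C) *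
        PW 0 (fun j => iteratedDeriv j f t) (fun j => iteratedDeriv j g t) (insert (n + k) B) := by
    rw [e1, key]
    rcases k with _ | j
    · simp [PE]
    · rw [sub_eq_iff_eq_add]
      congr 1
      unfold PE PP
      dsimp only
      rw [Finset.sum_congr rfl (g := fun _ => iteratedDeriv 2 f t * PQ (fun j => iteratedDeriv j f t)
        (fun j => iteratedDeriv j g t) 0 (Finset.range (n + j)) j)]
      · rw [Finset.sum_const, Finset.card_erase_of_mem (by simp), Finset.card_range,
          nsmul_eq_mul]
        rw [show n + (j + 1) - 1 = n + j by omega]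
        push_cast
        ring
      · intro x hx
        rw [show n + (j + 1) = n + j + 1 by omega] at hx ⊢
        rw [PQ_erase _ _ _ _ _ hx]
  rw [e3]
  unfold PP PQ
  apply HasDerivAt.fun_sum
  intro p hp
  rw [mem_PV] at hp
  have := HasDerivAt.fun_finsetProd (u := p) (x := t)
    (f := fun B τ => PW 0 (fun j => iteratedDeriv j f τ) (fun j => iteratedDeriv j g τ) B)
    (f' := fun B => PW 0 (fun j => iteratedDeriv j f t) (fun j => iteratedDeriv j g t) (insert (n + k) B))
    (by
      intro B hB
      have hc := hp.card_le (n := n) (by simp) hB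
      have hnB : n + k ∉ B := fun hc => by simpa using hp.sub B hB hc
      have h0 : (0 ∈ insert (n + k) B) ↔ 0 ∈ B := by
        rw [Finset.mem_insert]
        constructor
        · rintro (h | h)
          · omega
          · exact h
        · exact Or.inr
      unfold PW
      rw [Finset.card_insert_of_notMem hnB]
      simp only [h0]
      split_ifs
      · exact hg _ hc
      · exact hf _ hc)
  simpa only [smul_eq_mul] using this

theorem pSum_eq_PP (f g : ℝ → ℝ) (n k : ℕ) (hn : 1 ≤ n) (t : ℝ) :
    pSum f g n (k : ℤ) t = PP f g n k t := by
  have hN : 0 < n + k := by omega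
  have h := PQ_image (fun j => iteratedDeriv j f t) (fun j => iteratedDeriv j g t)
    (e := (Fin.val : Fin (n + k) → ℕ)) Fin.val_injective ⟨0, hN⟩ Finset.univ k
  have him : (Finset.univ : Finset (Fin (n + k))).image Fin.val = Finset.range (n + k) := by
    ext i
    simp only [Finset.mem_image, Finset.mem_univ, true_and, Finset.mem_range]
    exact ⟨fun ⟨j, hj⟩ => hj ▸ j.2, fun hi => ⟨⟨i, hi⟩, rfl⟩⟩
  rw [him] at h
  unfold PP
  dsimp only at h
  rw [h]
  unfold pSum PQ
  rw [if_neg (by omega)]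
  have h0 : ∀ B : Finset (Fin (n + k)), (∃ x ∈ B, (x : ℕ) = 0) ↔ (⟨0, hN⟩ : Fin (n + k)) ∈ B := by
    intro B
    constructor
    · rintro ⟨x, hx, hx0⟩
      have : x = ⟨0, hN⟩ := Fin.ext hx0
      exact this ▸ hx
    · intro h
      exact ⟨_, h, rfl⟩
  simp only [Int.toNat_natCast, h0]
  refine Finset.sum_congr ?_ ?_
  · ext p
    rw [mem_PV]
    simp only [Finset.mem_filter, Finset.mem_univ, true_and]
    constructor
    · rintro ⟨h1, h2, h3, h4⟩
      refine ⟨fun B _ => Finset.subset_univ _, h1, ?_, ?_, h3, fun B hB hc => (h0 B).1 (h4 B hB hc)⟩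
      · intro x _
        obtain ⟨B, hB, _⟩ := h2 x
        exact ⟨B, hB⟩
      · intro B hB C hC x hx hx'
        exact (h2 x).unique ⟨hB, hx⟩ ⟨hC, hx'⟩
    · rintro ⟨h1, h2, h3, h4, h5, h6⟩
      refine ⟨h2, ?_, h5, fun B hB hc => (h0 B).2 (h6 B hB hc)⟩
      intro x
      obtain ⟨B, hB, hx⟩ := h3 x (by simp)
      exact ⟨B, ⟨hB, hx⟩, fun C hC => h4 C hC.1 B hB x hC.2 hx⟩
  · intro p _
    refine Finset.prod_congr rfl fun B _ => ?_
    unfold PW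
    congr

theorem param_deriv {f G H : ℝ → ℝ} {t a b : ℝ} (hf : HasStrictDerivAt f a t) (ha : a ≠ 0)
    (hG : HasDerivAt G b t) (hh : ∀ᶠ τ in nhds t, H (f τ) = G τ) :
    HasDerivAt H (b * a⁻¹) (f t) := by
  have hl := (hf.to_localInverse ha).hasDerivAt
  have hi : hf.localInverse f a t ha (f t) = t := 
    HasStrictFDerivAt.localInverse_apply_image _
  have hr : ∀ᶠ y in nhds (f t), f (hf.localInverse f a t ha y) = y :=
    HasStrictFDerivAt.eventually_right_inverse _
  have hc : Filter.Tendsto (hf.localInverse f a t ha) (nhds (f t)) (nhds t) := by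
    have := hl.continuousAt.tendsto
    rwa [hi] at this
  have hcomp : HasDerivAt (G ∘ hf.localInverse f a t ha) (b * a⁻¹) (f t) :=
    HasDerivAt.comp (f t) (by rw [hi]; exact hG) hl
  refine hcomp.congr_of_eventuallyEq ?_
  filter_upwards [hr, hc.eventually hh] with y h1 h2
  rw [h1] at h2
  exact h2

theorem contDiffAt_iteratedDeriv_hasDerivAt {f : ℝ → ℝ} {t : ℝ} {n : ℕ} (hf : ContDiffAt ℝ n f t)
    {j : ℕ} (hj : j < n) : HasDerivAt (iteratedDeriv j f) (iteratedDeriv (j + 1) f t) t := by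
  rw [iteratedDeriv_succ]
  apply DifferentiableAt.hasDerivAt
  have := ContDiffWithinAt.differentiableWithinAt_iteratedDerivWithin (m := j)
    hf.contDiffWithinAt (s := Set.univ) (by exact_mod_cast hj) (by simp [uniqueDiffOn_univ])
  simpa [iteratedDerivWithin_univ, differentiableWithinAt_univ] using this

/-- the sum -/
noncomputable def PS (f g : ℝ → ℝ) (n : ℕ) (t : ℝ) : ℝ :=
  ∑ k ∈ Finset.range (n + 1), (-1 : ℝ) ^ k * (deriv f t) ^ (-(n : ℤ) - (k : ℤ)) * PP f g n k t

theorem PP_self (f g : ℝ → ℝ) (n : ℕ) (hn : 1 ≤ n) (t : ℝ) : PP f g n n t = 0 :=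
  PQ_zero _ _ (by simp; omega) (by simp; omega)

theorem PS_hasDerivAt (f g : ℝ → ℝ) (n : ℕ) (hn : 1 ≤ n) (t : ℝ) (ha : deriv f t ≠ 0)
    (hf : ∀ j ≤ n, HasDerivAt (iteratedDeriv j f) (iteratedDeriv (j + 1) f t) t)
    (hg : ∀ j ≤ n, HasDerivAt (iteratedDeriv j g) (iteratedDeriv (j + 1) g t) t) :
    HasDerivAt (PS f g n) (PS f g (n + 1) t * deriv f t) t := by
  have hd : HasDerivAt (deriv f) (iteratedDeriv 2 f t) t := by
    have := hf 1 hn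
    rwa [iteratedDeriv_one] at this
  have hs : HasDerivAt (PS f g n) (∑ k ∈ Finset.range (n + 1),
      ((-1 : ℝ) ^ k * (((-(n : ℤ) - (k : ℤ) : ℤ) : ℝ) * (deriv f t) ^ (-(n : ℤ) - (k : ℤ) - 1) *
          iteratedDeriv 2 f t) * PP f g n k t +
        (-1 : ℝ) ^ k * (deriv f t) ^ (-(n : ℤ) - (k : ℤ)) *
          (PP f g (n + 1) k t - PE f g n k t))) t := by
    unfold PS
    apply HasDerivAt.fun_sum
    intro k _
    refine HasDerivAt.fun_mul ?_ (PP_hasDerivAt f g n k hn t hf hg)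
    refine HasDerivAt.const_mul _ ?_
    exact (hasDerivAt_zpow (-(n : ℤ) - (k : ℤ)) _ (Or.inl ha)).comp t hd
  refine hs.congr_deriv ?_
  set a := deriv f t with ha'
  let E : ℕ → ℝ := fun k => (-1 : ℝ) ^ k * a ^ (-(n : ℤ) - (k : ℤ)) * PE f g n k t
  have hz : PP f g (n + 1) (n + 1) t = 0 := PP_self f g (n + 1) (by omega) t
  unfold PS
  rw [Finset.sum_range_succ _ (n + 1), hz, mul_zero, add_zero, Finset.sum_mul]
  have hterm : ∀ k ∈ Finset.range (n + 1), 
      ((-1 : ℝ) ^ k * (((-(n : ℤ) - (k : ℤ) : ℤ) : ℝ) * a ^ (-(n : ℤ) - (k : ℤ) - 1) *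
          iteratedDeriv 2 f t) * PP f g n k t +
        (-1 : ℝ) ^ k * a ^ (-(n : ℤ) - (k : ℤ)) *
          (PP f g (n + 1) k t - PE f g n k t)) =
      (-1 : ℝ) ^ k * a ^ (-((n + 1 : ℕ) : ℤ) - (k : ℤ)) * PP f g (n + 1) k t * a +
        (E (k + 1) - E k) := by
    intro k _
    have e1 : a ^ (-((n + 1 : ℕ) : ℤ) - (k : ℤ)) * a = a ^ (-(n : ℤ) - (k : ℤ)) := by
      rw [← zpow_add_one₀ ha]; congr 1; push_cast; ring
    have e2 : E (k + 1) = - (-1 : ℝ) ^ k * a ^ (-(n : ℤ) - (k : ℤ) - 1) *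
        (((n : ℝ) + k) * iteratedDeriv 2 f t * PP f g n k t) := by
      simp only [E, PE]
      rw [show (-(n : ℤ) - ((k + 1 : ℕ) : ℤ)) = -(n : ℤ) - (k : ℤ) - 1 by push_cast; ring]
      ring
    rw [e2]
    simp only [E]
    push_cast at e1 ⊢
    linear_combination (-(-1 : ℝ) ^ k * PP f g (n + 1) k t) * e1
  rw [Finset.sum_congr rfl hterm, Finset.sum_add_distrib, Finset.sum_range_sub]
  simp [E, PE, PP_self f g n hn t, ha']

/-- **The nth derivative of a parametrically given function.**
If `x = f t` and `y = g t` with `f, g` n-times continuously differentiable near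
`t₀` and `f' t₀ ≠ 0`, and `h` satisfies `h (f t) = g t` for `t` near `t₀`, then
for every `n ≥ 1`,
`dⁿy/dxⁿ` at `x₀ = f t₀` equals `∑_{k=0}^{n-1} (-1)^k [f'(t₀)]^(−n−k) P_{n,k}(t₀)`. -/
theorem nth_deriv_parametric (f g h : ℝ → ℝ) (t₀ : ℝ) (n : ℕ) (hn : 1 ≤ n)
    (hf : ContDiffAt ℝ n f t₀) (hg : ContDiffAt ℝ n g t₀)
    (hf' : deriv f t₀ ≠ 0)
    (hh : ∀ᶠ t in nhds t₀, h (f t) = g t) :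
    iteratedDeriv n h (f t₀) =
      ∑ k ∈ Finset.range n,
        (-1 : ℝ) ^ k * (deriv f t₀) ^ (-(n : ℤ) - (k : ℤ)) * pSum f g n (k : ℤ) t₀ := by
  have hn0 : ((n : ℕ) : WithTop ℕ∞) ≠ 0 := by exact_mod_cast (by omega : n ≠ 0)
  have hF : ∀ᶠ t in nhds t₀, ContDiffAt ℝ n f t := hf.eventually (by simp)
  have hG : ∀ᶠ t in nhds t₀, ContDiffAt ℝ n g t := hg.eventually (by simp)
  have hd : ∀ᶠ t in nhds t₀, deriv f t ≠ 0 := by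
    have hc : ContinuousAt (deriv f) t₀ := by
      exact (hf.continuousAt_fderiv hn0).clm_apply continuousAt_const
    exact hc.eventually_ne hf'
  have main : ∀ m : ℕ, m + 1 ≤ n →
      ∀ᶠ t in nhds t₀, iteratedDeriv (m + 1) h (f t) = PS f g (m + 1) t := by
    intro m
    induction m with
    | zero =>
      intro _
      filter_upwards [hF, hG, hd, hh.eventually_nhds] with t h1 h2 h3 h4
      have hgd := contDiffAt_iteratedDeriv_hasDerivAt h2 (j := 0) (by omega)
      rw [iteratedDeriv_zero] at hgd
      have := param_deriv (h1.hasStrictDerivAt hn0) h3 hgd h4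
      rw [zero_add, iteratedDeriv_one, this.deriv]
      unfold PS
      rw [Finset.sum_range_succ, PP_self f g 1 le_rfl, Finset.sum_range_one]
      unfold PP
      rw [PQ_one]
      simp [mul_comm]
    | succ m ih =>
      intro hm
      filter_upwards [hF, hG, hd, (ih (by omega)).eventually_nhds] with t h1 h2 h3 h4
      have hS := PS_hasDerivAt f g (m + 1) (by omega) t h3
        (fun j hj => contDiffAt_iteratedDeriv_hasDerivAt h1 (by omega))
        (fun j hj => contDiffAt_iteratedDeriv_hasDerivAt h2 (by omega))
      have := param_deriv (h1.hasStrictDerivAt hn0) h3 hS h4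
      rw [iteratedDeriv_succ, this.deriv, mul_assoc, mul_inv_cancel₀ h3, mul_one]
  obtain ⟨m, rfl⟩ : ∃ m, n = m + 1 := ⟨n - 1, by omega⟩
  rw [(main m le_rfl).self_of_nhds]
  unfold PS
  rw [Finset.sum_range_succ, PP_self f g (m + 1) hn, mul_zero, add_zero]
  refine Finset.sum_congr rfl fun k _ => ?_
  rw [pSum_eq_PP f g (m + 1) k hn]
end

section
/- Let f : ℝ → ℝ be (n+1)-times continuously differentiable near t₀ with f'(t₀) ≠ 0, and let h be the local inverse function of f near x₀ = f(t₀) (so h(f(t)) = t near t₀). Then for every n ≥ 1, the nth derivative of h at x₀ equals the sum over k from 0 to n−1 of (−1)ᵏ · [f'(t₀)]^(−n−k) · Q_{n,k}(t₀), where Q_{n,k}(t) is the sum, over all set partitions of {1, 2, …, n+k} into k+1 blocks in which the block containing the element 1 is the singleton {1} and no other block is a singleton, of the product f^(b₂)(t) ⋯ f^(b_{k+1})(t) over the sizes b₂, …, b_{k+1} of the blocks other than {1}. -/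
open scoped Classical in
/-- `qSum f n k t` is `Q_{n,k}(t)`: the sum over all set partitions of
`{1, …, n+k}` (encoded as `Fin (n + k)`, the element `1` corresponding to the
member of value `0`) into `k+1` blocks in which the block containing `1` is the
singleton `{1}` and no other block is a singleton, of the products
`f^(b₂)(t) ⋯ f^(b_{k+1})(t)` over the sizes `b₂, …, b_{k+1}` of the blocks
other than `{1}`.  It is `0` when `k < 0` or when no such partition exists. -/
noncomputable def qSum (f : ℝ → ℝ) (n : ℕ) (k : ℤ) (t : ℝ) : ℝ :=
  if k < 0 then 0 else
    ∑ part ∈ Finset.univ.filter (fun part : Finset (Finset (Fin (n + k.toNat))) =>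
        (∀ B ∈ part, B.Nonempty) ∧
        (∀ x, ∃! B, B ∈ part ∧ x ∈ B) ∧
        part.card = k.toNat + 1 ∧
        ∀ B ∈ part, (B.card = 1 ↔ ∃ x ∈ B, (x : ℕ) = 0)),
      ∏ B ∈ part,
        if ∃ x ∈ B, (x : ℕ) = 0 then 1 else iteratedDeriv B.card f t

/-- weighted count of partitions, recursively -/
noncomputable def pc (w : ℕ → ℝ) : ℕ → ℕ → ℝ
  | 0, m => if m = 0 then 1 else 0
  | _ + 1, 0 => 0
  | k + 1, m + 1 => ∑ j ∈ Finset.range (m + 1), (m.choose j : ℝ) * (w (j + 1) * pc w k (m - j))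

noncomputable def pe (w : ℕ → ℝ) : ℕ → ℕ → ℝ
  | 0, _ => 0
  | k + 1, m => m * pc w k (m - 1)

theorem pc_vanish (w : ℕ → ℝ) (h1 : w 1 = 0) (k m : ℕ) (h : m < 2 * k) : pc w k m = 0 := by
  induction k generalizing m with
  | zero => omega
  | succ k ih =>
    cases m with
    | zero => rfl
    | succ m =>
      rw [pc]
      refine Finset.sum_eq_zero fun j hj => ?_
      have hjm := Finset.mem_range.mp hj
      rcases Nat.eq_zero_or_pos j with rfl | hj0
      · simp [h1]
      · rw [ih (m - j) (by omega)]; simp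

theorem pe_sum (w : ℕ → ℝ) (k m : ℕ) :
    ∑ j ∈ Finset.range (m + 1), (m.choose j : ℝ) * (w (j + 1) * pe w k (m - j))
      = m * pc w k m := by
  cases k with
  | zero =>
    simp only [pe, pc]
    split_ifs with h <;> simp [h]
  | succ k =>
    cases m with
    | zero => simp [pe]
    | succ m =>
      rw [Finset.sum_range_succ]
      simp only [pe, pc, Finset.mul_sum]
      simp only [Nat.sub_self, Nat.cast_zero, zero_mul, mul_zero, add_zero]
      refine Finset.sum_congr rfl fun j hj => ?_
      have hj' : j ≤ m := by simpa [Nat.lt_succ_iff] using hj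
      have e := Nat.choose_mul_succ_eq m j
      have e' : (m.choose j : ℝ) * ((m + 1 : ℕ) : ℝ) = ((m+1).choose j : ℝ) * ((m + 1 - j : ℕ) : ℝ) := by
        exact_mod_cast e
      have e2 : m + 1 - j - 1 = m - j := by omega
      rw [e2]
      linear_combination (-(w (j+1) * pc w k (m - j))) * e'

theorem pc_succ_succ (w : ℕ → ℝ) (k m : ℕ) :
    pc w (k + 1) (m + 2) =
      ∑ j ∈ Finset.range (m + 1), (m.choose j : ℝ) * (w (j + 1) * pc w k (m + 1 - j))
      + ∑ j ∈ Finset.range (m + 1), (m.choose j : ℝ) * (w (j + 2) * pc w k (m - j)) := by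
  rw [pc]
  exact Finset.sum_choose_succ_mul (fun i j => w (i + 1) * pc w k j) m

theorem pc_hasDerivAt (w : ℝ → ℕ → ℝ) (t : ℝ) (N : ℕ) (h1 : ∀ s, w s 1 = 0)
    (hw : ∀ j, 2 ≤ j → j ≤ N → HasDerivAt (fun s => w s j) (w t (j + 1)) t)
    (k m : ℕ) (h : m + 2 ≤ N + 2 * k) :
    HasDerivAt (fun s => pc (w s) k m) (pc (w t) k (m + 1) - w t 2 * pe (w t) k m) t := by
  induction k generalizing m with
  | zero =>
    simp only [pc, pe]
    simpa using hasDerivAt_const t _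
  | succ k ih =>
    cases m with
    | zero =>
      have : pc (w t) (k+1) (0+1) = 0 := pc_vanish _ (h1 t) _ _ (by omega)
      simp only [this, pe]
      simpa [pc] using hasDerivAt_const t (0:ℝ)
    | succ m =>
      have key : ∀ j ∈ Finset.range (m + 1),
          HasDerivAt (fun s => (m.choose j : ℝ) * (w s (j + 1) * pc (w s) k (m - j)))
            ((m.choose j : ℝ) * ((if j = 0 then 0 else w t (j + 2)) * pc (w t) k (m - j) +
              w t (j + 1) * (pc (w t) k (m + 1 - j) - w t 2 * pe (w t) k (m - j)))) t := by
        intro j hj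
        have hj' : j ≤ m := by simpa [Nat.lt_succ_iff] using hj
        refine HasDerivAt.const_mul _ ?_
        rcases Nat.eq_zero_or_pos j with rfl | hj0
        · simp only [zero_add, h1, zero_mul, if_true, add_zero]
          exact hasDerivAt_const t (0:ℝ)
        · have I := ih (m - j) (by omega)
          rw [show m - j + 1 = m + 1 - j by omega] at I
          rw [if_neg (by omega)]
          by_cases hN : j + 1 ≤ N
          · exact (hw (j+1) (by omega) hN).mul I
          · have z : ∀ s, pc (w s) k (m - j) = 0 := fun s => pc_vanish _ (h1 s) _ _ (by omega)
            simp only [z] at I ⊢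
            have := I.unique (hasDerivAt_const t (0:ℝ))
            rw [this]
            simpa using hasDerivAt_const t (0:ℝ)
      have S := HasDerivAt.fun_sum key
      simp only [pc]
      refine S.congr_deriv ?_
      have P := pc_succ_succ (w t) k m
      have E := pe_sum (w t) k m
      have A : ∑ j ∈ Finset.range (m + 1), (m.choose j : ℝ) * ((if j = 0 then 0 else w t (j + 2)) * pc (w t) k (m - j))
         = ∑ j ∈ Finset.range (m + 1), (m.choose j : ℝ) * (w t (j + 2) * pc (w t) k (m - j)) - w t 2 * pc (w t) k m := by
        rw [Finset.sum_range_succ', Finset.sum_range_succ']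
        simp
      have B : ∑ j ∈ Finset.range (m + 1), ((m.choose j : ℝ) * ((if j = 0 then 0 else w t (j + 2)) * pc (w t) k (m - j) +
              w t (j + 1) * (pc (w t) k (m + 1 - j) - w t 2 * pe (w t) k (m - j))))
          = ∑ j ∈ Finset.range (m + 1), (m.choose j : ℝ) * ((if j = 0 then 0 else w t (j + 2)) * pc (w t) k (m - j))
          + ∑ j ∈ Finset.range (m + 1), (m.choose j : ℝ) * (w t (j + 1) * pc (w t) k (m + 1 - j))
          - w t 2 * ∑ j ∈ Finset.range (m + 1), (m.choose j : ℝ) * (w t (j + 1) * pe (w t) k (m - j)) := by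
        rw [Finset.mul_sum, ← Finset.sum_add_distrib, ← Finset.sum_sub_distrib]
        refine Finset.sum_congr rfl fun j _ => ?_
        ring
      rw [B, A, E]
      simp only [pc] at P
      rw [P]
      simp only [pe, Nat.add_sub_cancel]
      push_cast
      ring

theorem deriv_step (f g φ : ℝ → ℝ) (t f' φ' : ℝ) (hf : HasStrictDerivAt f f' t) (hf' : f' ≠ 0)
    (hφ : HasDerivAt φ φ' t) (hg : ∀ᶠ s in nhds t, g (f s) = φ s) :
    deriv g (f t) = φ' * f'⁻¹ := by
  have hl := hf.to_localInverse hf'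
  have hl0 : hf.localInverse f f' t hf' (f t) = t :=
    HasStrictFDerivAt.localInverse_apply_image (hf.hasStrictFDerivAt_equiv hf')
  have hr : ∀ᶠ y in nhds (f t), f (hf.localInverse f f' t hf' y) = y :=
    HasStrictFDerivAt.eventually_right_inverse (hf.hasStrictFDerivAt_equiv hf')
  have hc : Filter.Tendsto (hf.localInverse f f' t hf') (nhds (f t)) (nhds t) := by
    have := hl.hasDerivAt.continuousAt.tendsto
    rwa [hl0] at this
  have hφ2 : HasDerivAt φ φ' (hf.localInverse f f' t hf' (f t)) := by rwa [hl0]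
  have hcomp := hφ2.comp (f t) hl.hasDerivAt
  refine (hcomp.congr_of_eventuallyEq ?_).deriv
  filter_upwards [hr, hc.eventually hg] with y h1 h2
  simp only [Function.comp]
  rw [← h2, h1]

noncomputable def wf (f : ℝ → ℝ) (t : ℝ) (j : ℕ) : ℝ := if j = 1 then 0 else iteratedDeriv j f t

theorem main_formula (f h : ℝ → ℝ) (t₀ : ℝ) (N : ℕ)
    (hf : ContDiffAt ℝ (N + 1) f t₀) (hf' : deriv f t₀ ≠ 0)
    (hh : ∀ᶠ t in nhds t₀, h (f t) = t) (p : ℕ) (hp : p + 1 ≤ N) :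
    ∀ᶠ t in nhds t₀, iteratedDeriv (p + 1) h (f t) =
      ∑ k ∈ Finset.range (p + 1),
        (-1 : ℝ) ^ k * (deriv f t) ^ (-((p + 1 : ℕ) : ℤ) - (k : ℤ)) * pc (wf f t) k (p + k) := by
  have hC : ∀ᶠ t in nhds t₀, ContDiffAt ℝ (N + 1) f t := hf.eventually (by
    exact_mod_cast WithTop.coe_ne_top)
  have hd : ∀ᶠ t in nhds t₀, deriv f t ≠ 0 := by
    have hc : ContinuousAt (deriv f) t₀ := by
      exact (hf.derivWithin (m := 0) (by norm_cast; omega)).continuousAt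
    exact hc.eventually_ne hf'
  have hJ : ∀ t, ContDiffAt ℝ (N + 1) f t → ∀ j ≤ N,
      HasDerivAt (iteratedDeriv j f) (iteratedDeriv (j + 1) f t) t := by
    intro t ht j hj
    rw [iteratedDeriv_succ]
    refine DifferentiableAt.hasDerivAt ?_
    have : ∀ j ≤ N, ContDiffAt ℝ ((N + 1 - j : ℕ) : WithTop ℕ∞) (iteratedDeriv j f) t := by
      intro j hj
      induction j with
      | zero => simpa using ht
      | succ j ih =>
        rw [iteratedDeriv_succ]
        exact (ih (by omega)).derivWithin (by norm_cast; omega)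
    exact (this j hj).differentiableAt (by norm_cast; omega)
  have hS : ∀ t, ContDiffAt ℝ (N + 1) f t → HasStrictDerivAt f (deriv f t) t := fun t ht =>
    ht.hasStrictDerivAt (by norm_cast)
  induction p with
  | zero =>
    filter_upwards [hC, hd, hh.eventually_nhds] with t h1 h2 h3
    have := deriv_step f h id t _ _ (hS t h1) h2 (hasDerivAt_id t) h3
    simp [iteratedDeriv_one, this, pc]
  | succ p ih =>
    filter_upwards [hC, hd, (ih (by omega)).eventually_nhds] with t h1 h2 h3
    have w1 : ∀ s, wf f s 1 = 0 := fun s => by simp [wf]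
    have hw : ∀ j, 2 ≤ j → j ≤ N → HasDerivAt (fun s => wf f s j) (wf f t (j + 1)) t := by
      intro j h2 hj
      simp only [wf, if_neg (show j ≠ 1 by omega), if_neg (show j + 1 ≠ 1 by omega)]
      exact hJ t h1 j hj
    have hf2 : HasDerivAt (deriv f) (wf f t 2) t := by
      have := hJ t h1 1 (by omega)
      rw [iteratedDeriv_one] at this
      simpa [wf] using this
    have key : ∀ k ∈ Finset.range (p + 1), HasDerivAt (fun t =>
        (-1 : ℝ) ^ k * (deriv f t) ^ (-((p + 1 : ℕ) : ℤ) - (k : ℤ)) * pc (wf f t) k (p + k))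
        ((-1 : ℝ) ^ k * ((((-((p + 1 : ℕ) : ℤ) - (k : ℤ) : ℤ) : ℝ) * (deriv f t) ^ (-((p + 1 : ℕ) : ℤ) - (k : ℤ) - 1) * wf f t 2)) * pc (wf f t) k (p + k)
          + (-1 : ℝ) ^ k * (deriv f t) ^ (-((p + 1 : ℕ) : ℤ) - (k : ℤ)) * (pc (wf f t) k (p + k + 1) - wf f t 2 * pe (wf f t) k (p + k))) t := by
      intro k hk
      have a := pc_hasDerivAt (wf f) t N w1 hw k (p + k) (by simp at hk; omega)
      have b := ((hasDerivAt_zpow (-((p + 1 : ℕ) : ℤ) - (k : ℤ)) (deriv f t) (Or.inl h2)).comp t hf2).const_mul ((-1 : ℝ) ^ k)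
      exact b.mul a
    have S := HasDerivAt.fun_sum key
    have D := deriv_step f (iteratedDeriv (p + 1) h) _ t _ _ (hS t h1) h2 S h3
    rw [iteratedDeriv_succ, D]
    set c := wf f t with hc
    set a := deriv f t with ha
    have last : pc c (p + 1) (p + 1 + (p + 1)) = c 2 * pe c (p + 1) (p + (p + 1)) := by
      have I := pc_hasDerivAt (wf f) t N w1 hw (p + 1) (p + (p + 1)) (by omega)
      have z : ∀ s, pc (wf f s) (p + 1) (p + (p + 1)) = 0 :=
        fun s => pc_vanish _ (w1 s) _ _ (by omega)
      simp only [z] at I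
      have := I.unique (hasDerivAt_const t (0:ℝ))
      rw [show p + 1 + (p + 1) = p + (p + 1) + 1 by ring]
      linarith
    have X := Finset.sum_range_sub (fun k : ℕ => (-1 : ℝ) ^ k *
      a ^ (-((p + 1 + 1 : ℕ) : ℤ) - (k : ℤ)) * (c 2 * pe c k (p + k))) (p + 1)
    rw [Finset.sum_range_succ _ (p + 1), last, Finset.sum_mul]
    have X0 : pe c 0 (p + 0) = 0 := rfl
    rw [X0, mul_zero, mul_zero, sub_zero] at X
    rw [← X, ← Finset.sum_add_distrib]
    refine Finset.sum_congr rfl fun k _ => ?_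
    rw [show p + (k + 1) = p + k + 1 by ring, show p + 1 + k = p + k + 1 by ring]
    have e1 : a ^ (-((p + 1 : ℕ) : ℤ) - (k : ℤ) - 1) = a ^ (-((p + 1 + 1 : ℕ) : ℤ) - (k : ℤ)) := by
      congr 1; push_cast; ring
    have e2 : a ^ (-((p + 1 : ℕ) : ℤ) - (k : ℤ)) = a ^ (-((p + 1 + 1 : ℕ) : ℤ) - (k : ℤ)) * a := by
      rw [← zpow_add_one₀ h2]; congr 1; push_cast; ring
    have e3 : a ^ (-((p + 1 + 1 : ℕ) : ℤ) - ((k + 1 : ℕ) : ℤ)) =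
        a ^ (-((p + 1 + 1 : ℕ) : ℤ) - (k : ℤ)) * a⁻¹ := by
      rw [← zpow_sub_one₀ h2]; congr 1; push_cast; ring
    have e4 : pe c (k + 1) (p + k + 1) = ((p + k + 1 : ℕ) : ℝ) * pc c k (p + k) := rfl
    rw [e1, e2, e3, e4]
    generalize a ^ (-((p + 1 + 1 : ℕ) : ℤ) - (k : ℤ)) = y
    push_cast
    field_simp
    ring

def IsPt {α : Type*} (A : Finset α) (P : Finset (Finset α)) : Prop :=
  (∀ B ∈ P, B.Nonempty) ∧ (∀ B ∈ P, B ⊆ A) ∧ ∀ x ∈ A, ∃! B, B ∈ P ∧ x ∈ B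

theorem IsPt.ins {α : Type*} [DecidableEq α] {A T : Finset α} {Q : Finset (Finset α)} {a : α}
    (ha : a ∉ A) (hT : T ⊆ A) (hQ : IsPt (A \ T) Q) :
    IsPt (insert a A) (insert (insert a T) Q) := by
  obtain ⟨h1, h2, h3⟩ := hQ
  refine ⟨?_, ?_, ?_⟩
  · intro B hB
    rcases Finset.mem_insert.mp hB with rfl | hB
    · exact ⟨a, by simp⟩
    · exact h1 B hB
  · intro B hB
    rcases Finset.mem_insert.mp hB with rfl | hB
    · exact Finset.insert_subset_insert _ hT
    · exact (h2 B hB).trans (Finset.sdiff_subset.trans (Finset.subset_insert _ _))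
  · intro x hx
    by_cases hxT : x ∈ insert a T
    · refine ⟨_, ⟨Finset.mem_insert_self _ _, hxT⟩, ?_⟩
      rintro B ⟨hB, hxB⟩
      rcases Finset.mem_insert.mp hB with rfl | hB
      · rfl
      · have := h2 B hB hxB
        grind
    · obtain ⟨B, ⟨hB, hxB⟩, hu⟩ := h3 x (by grind)
      refine ⟨B, ⟨Finset.mem_insert_of_mem hB, hxB⟩, ?_⟩
      rintro C ⟨hC, hxC⟩
      rcases Finset.mem_insert.mp hC with rfl | hC
      · exact absurd hxC hxT
      · exact hu C ⟨hC, hxC⟩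

theorem IsPt.notMem {α : Type*} [DecidableEq α] {A T : Finset α} {Q : Finset (Finset α)} {a : α}
    (ha : a ∉ A) (hQ : IsPt (A \ T) Q) : insert a T ∉ Q := by
  intro h
  have := hQ.2.1 _ h (Finset.mem_insert_self a T)
  grind

theorem IsPt.uniq {α : Type*} {A : Finset α} {P : Finset (Finset α)} (hP : IsPt A P)
    {B C : Finset α} (hB : B ∈ P) (hC : C ∈ P) {x : α} (hxB : x ∈ B) (hxC : x ∈ C) : B = C :=
  (hP.2.2 x (hP.2.1 B hB hxB)).unique ⟨hB, hxB⟩ ⟨hC, hxC⟩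

theorem IsPt.erase {α : Type*} [DecidableEq α] {A B : Finset α} {P : Finset (Finset α)} {a : α}
    (ha : a ∉ A) (hP : IsPt (insert a A) P) (hB : B ∈ P) (haB : a ∈ B) :
    IsPt (A \ B.erase a) (P.erase B) := by
  refine ⟨fun C hC => hP.1 C (Finset.mem_of_mem_erase hC), ?_, ?_⟩
  · intro C hC x hx
    have hCP := Finset.mem_of_mem_erase hC
    have hne := Finset.ne_of_mem_erase hC
    have hxA := hP.2.1 C hCP hx
    have hxB : x ∉ B := fun h => hne (hP.uniq hCP hB hx h)
    grind
  · intro x hx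
    have hxA : x ∈ A := by grind
    have hxB : x ∉ B := by grind
    obtain ⟨C, ⟨hC, hxC⟩, hu⟩ := hP.2.2 x (Finset.mem_insert_of_mem hxA)
    refine ⟨C, ⟨Finset.mem_erase.mpr ⟨?_, hC⟩, hxC⟩, ?_⟩
    · rintro rfl; exact hxB hxC
    · rintro D ⟨hD, hxD⟩
      exact hu D ⟨Finset.mem_of_mem_erase hD, hxD⟩

open scoped Classical in
noncomputable def pw {α : Type*} [Fintype α] (w : ℕ → ℝ) (A : Finset α) (k : ℕ) : ℝ :=
  ∑ P ∈ Finset.univ.filter (fun P : Finset (Finset α) => IsPt A P ∧ P.card = k), ∏ B ∈ P, w B.card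

open scoped Classical in
theorem pw_insert {α : Type*} [Fintype α] (w : ℕ → ℝ) (A : Finset α) (a : α) (ha : a ∉ A) (k : ℕ) :
    pw w (insert a A) (k + 1) = ∑ T ∈ A.powerset, w (T.card + 1) * pw w (A \ T) k := by
  simp only [pw, Finset.mul_sum]
  rw [Finset.sum_sigma']
  symm
  refine Finset.sum_bij (fun x _ => insert (insert a x.1) x.2) ?_ ?_ ?_ ?_
  · rintro ⟨T, Q⟩ h
    simp only [Finset.mem_sigma, Finset.mem_powerset, Finset.mem_filter, Finset.mem_univ,
      true_and] at h ⊢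
    obtain ⟨hT, hQ, hk⟩ := h
    exact ⟨hQ.ins ha hT, by rw [Finset.card_insert_of_notMem (hQ.notMem ha), hk]⟩
  · rintro ⟨T, Q⟩ h ⟨T', Q'⟩ h' e
    simp only [Finset.mem_sigma, Finset.mem_powerset, Finset.mem_filter, Finset.mem_univ,
      true_and] at h h' e
    obtain ⟨hT, hQ, hk⟩ := h
    obtain ⟨hT', hQ', hk'⟩ := h'
    have hP := hQ'.ins ha hT'
    have e1 : insert a T = insert a T' := by
      refine hP.uniq (x := a) ?_ ?_ (by simp) (by simp)
      · rw [← e]; simp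
      · simp
    have e2 : T = T' := by
      have := congrArg (fun S => S.erase a) e1
      simpa [Finset.erase_insert (fun h => ha (hT h)), Finset.erase_insert (fun h => ha (hT' h))] using this
    subst e2
    have := congrArg (fun S => S.erase (insert a T)) e
    simp only [Finset.erase_insert (hQ.notMem ha), Finset.erase_insert (hQ'.notMem ha)] at this
    rw [this]
  · intro P hP
    simp only [Finset.mem_filter, Finset.mem_univ, true_and] at hP
    obtain ⟨hP, hk⟩ := hP
    obtain ⟨B, ⟨hB, haB⟩, -⟩ := hP.2.2 a (by simp)
    refine ⟨⟨B.erase a, P.erase B⟩, ?_, ?_⟩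
    · simp only [Finset.mem_sigma, Finset.mem_powerset, Finset.mem_filter, Finset.mem_univ,
        true_and]
      refine ⟨?_, hP.erase ha hB haB, by rw [Finset.card_erase_of_mem hB, hk]; rfl⟩
      have := hP.2.1 B hB
      grind
    · simp only [Finset.insert_erase haB, Finset.insert_erase hB]
  · rintro ⟨T, Q⟩ h
    simp only [Finset.mem_sigma, Finset.mem_powerset, Finset.mem_filter, Finset.mem_univ,
      true_and] at h ⊢
    obtain ⟨hT, hQ, hk⟩ := h
    rw [Finset.prod_insert (hQ.notMem ha), Finset.card_insert_of_notMem (fun h => ha (hT h))]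

theorem pw_eq_pc {α : Type*} [Fintype α] (w : ℕ → ℝ) (A : Finset α) (k : ℕ) :
    pw w A k = pc w k A.card := by
  classical
  induction k generalizing A with
  | zero =>
    simp only [pw, pc, Finset.card_eq_zero]
    split_ifs with h
    · subst h
      rw [Finset.sum_eq_single ∅]
      · simp
      · intro P hP hne
        simp only [Finset.mem_filter] at hP
        exact absurd hP.2.2 hne
      · intro hn
        exact absurd (by simp [IsPt]) hn
    · refine Finset.sum_eq_zero fun P hP => ?_
      simp only [Finset.mem_filter, Finset.mem_univ, true_and] at hP
      obtain ⟨hP, rfl⟩ := hP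
      obtain ⟨x, hx⟩ := Finset.nonempty_iff_ne_empty.mpr h
      obtain ⟨B, ⟨hB, -⟩, -⟩ := hP.2.2 x hx
      simp at hB
  | succ k ih =>
    rcases Finset.eq_empty_or_nonempty A with rfl | ⟨a, haA⟩
    · simp only [Finset.card_empty, pc, pw]
      refine Finset.sum_eq_zero fun P hP => ?_
      simp only [Finset.mem_filter, Finset.mem_univ, true_and] at hP
      obtain ⟨hP, hk⟩ := hP
      obtain ⟨B, hB⟩ : P.Nonempty := Finset.card_pos.mp (by omega)
      obtain ⟨x, hx⟩ := hP.1 B hB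
      simpa using hP.2.1 B hB hx
    · obtain ⟨A', ha, rfl⟩ : ∃ A', a ∉ A' ∧ A = insert a A' :=
        ⟨A.erase a, by simp, by rw [Finset.insert_erase haA]⟩
      rw [pw_insert w A' a ha, Finset.card_insert_of_notMem ha, pc]
      have : ∀ T ∈ A'.powerset, w (T.card + 1) * pw w (A' \ T) k
          = (fun j => w (j + 1) * pc w k (A'.card - j)) T.card := by
        intro T hT
        rw [ih, Finset.card_sdiff_of_subset (Finset.mem_powerset.mp hT)]
      rw [Finset.sum_congr rfl this, Finset.sum_powerset_apply_card (fun j => w (j + 1) * pc w k (A'.card - j))]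
      simp [nsmul_eq_mul]

theorem qSum_eq (f : ℝ → ℝ) (p k : ℕ) (t : ℝ) :
    qSum f (p + 1) (k : ℤ) t = pc (wf f t) k (p + k) := by
  classical
  have hcard : (Finset.univ.erase (⟨0, by omega⟩ : Fin (p + 1 + k))).card = p + k := by
    rw [Finset.card_erase_of_mem (Finset.mem_univ _), Finset.card_univ, Fintype.card_fin]; omega
  rw [← hcard, ← pw_eq_pc]
  unfold qSum pw
  rw [if_neg (by omega)]
  simp only [Int.toNat_natCast]
  set z : Fin (p + 1 + k) := ⟨0, by omega⟩ with hz
  have hex : ∀ B : Finset (Fin (p + 1 + k)), (∃ x ∈ B, (x : ℕ) = 0) ↔ z ∈ B := by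
    intro B
    constructor
    · rintro ⟨x, hx, h0⟩
      rwa [show z = x from Fin.ext h0.symm]
    · intro h; exact ⟨z, h, rfl⟩
  simp only [hex]
  have hzA : z ∉ Finset.univ.erase z := by simp
  have hQe : Finset.univ.erase z \ (∅ : Finset _) = Finset.univ.erase z := by simp
  have hins : insert z (Finset.univ.erase z) = Finset.univ := by simp
  symm
  rw [← Finset.sum_filter_of_ne (p := fun P => ∀ B ∈ P, B.card ≠ 1)]
  swap
  · intro P _ hne B hB h1
    exact hne (Finset.prod_eq_zero hB (by simp [wf, h1]))
  have hnz : ∀ Q, IsPt (Finset.univ.erase z) Q → {z} ∉ Q := fun Q hQ h => by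
    simpa using hQ.2.1 _ h (Finset.mem_singleton_self z)
  have hnz2 : ∀ Q, IsPt (Finset.univ.erase z) Q → ∀ B ∈ Q, z ∉ B := fun Q hQ B h hB => by
    simpa using hQ.2.1 _ h hB
  refine Finset.sum_bij (fun Q _ => insert {z} Q) ?_ ?_ ?_ ?_
  · intro Q h
    simp only [Finset.mem_filter, Finset.mem_univ, true_and] at h ⊢
    obtain ⟨⟨hQ, hk⟩, h1⟩ := h
    have hI := IsPt.ins (T := ∅) hzA (by simp) (by rwa [hQe])
    rw [hins] at hI
    simp only [insert_empty_eq] at hI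
    refine ⟨hI.1, fun x => hI.2.2 x (Finset.mem_univ x), ?_, ?_⟩
    · rw [Finset.card_insert_of_notMem (hnz Q hQ), hk]
    · intro B hB
      rcases Finset.mem_insert.mp hB with rfl | hB
      · simp
      · simp [h1 B hB, hnz2 Q hQ B hB]
  · intro Q h Q' h' e
    simp only [Finset.mem_filter, Finset.mem_univ, true_and] at h h' e
    have := congrArg (fun S => S.erase {z}) e
    simpa only [Finset.erase_insert (hnz Q h.1.1), Finset.erase_insert (hnz Q' h'.1.1)] using this
  · intro P hP
    simp only [Finset.mem_filter, Finset.mem_univ, true_and] at hP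
    obtain ⟨a1, a2, a3, a4⟩ := hP
    have hPt : IsPt (insert z (Finset.univ.erase z)) P := by
      rw [hins]; exact ⟨a1, fun _ _ => Finset.subset_univ _, fun x _ => a2 x⟩
    obtain ⟨B, ⟨hB, hzB⟩, -⟩ := a2 z
    have hBz : B = {z} := by
      obtain ⟨y, rfl⟩ := Finset.card_eq_one.mp ((a4 B hB).mpr hzB)
      rw [Finset.mem_singleton.mp hzB]
    subst hBz
    have hE := hPt.erase hzA hB hzB
    simp only [Finset.erase_singleton, hQe] at hE
    refine ⟨P.erase {z}, ?_, Finset.insert_erase hB⟩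
    simp only [Finset.mem_filter, Finset.mem_univ, true_and]
    refine ⟨⟨hE, by rw [Finset.card_erase_of_mem hB, a3]; rfl⟩, ?_⟩
    intro C hC h1
    exact hnz2 _ hE C hC ((a4 C (Finset.mem_of_mem_erase hC)).mp h1)
  · intro Q h
    simp only [Finset.mem_filter, Finset.mem_univ, true_and] at h
    obtain ⟨⟨hQ, hk⟩, h1⟩ := h
    rw [Finset.prod_insert (hnz Q hQ), if_pos (Finset.mem_singleton_self z), one_mul]
    refine Finset.prod_congr rfl fun B hB => ?_
    rw [if_neg (hnz2 Q hQ B hB), wf, if_neg (h1 B hB)]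

/-- **The nth derivative of an inverse function (Sylvester's formula).**
If `f` is `(n+1)`-times continuously differentiable near `t₀` with `f' t₀ ≠ 0` and
`h` is the local inverse of `f` near `x₀ = f t₀` (i.e. `h (f t) = t` near `t₀`),
then for every `n ≥ 1`,
`h⁽ⁿ⁾(x₀) = ∑_{k=0}^{n-1} (-1)^k [f'(t₀)]^(−n−k) Q_{n,k}(t₀)`. -/
theorem nth_deriv_inverse (f h : ℝ → ℝ) (t₀ : ℝ) (n : ℕ) (hn : 1 ≤ n)
    (hf : ContDiffAt ℝ (n + 1) f t₀) (hf' : deriv f t₀ ≠ 0)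
    (hh : ∀ᶠ t in nhds t₀, h (f t) = t) :
    iteratedDeriv n h (f t₀) =
      ∑ k ∈ Finset.range n,
        (-1 : ℝ) ^ k * (deriv f t₀) ^ (-(n : ℤ) - (k : ℤ)) * qSum f n (k : ℤ) t₀ := by
  obtain ⟨p, rfl⟩ : ∃ p, n = p + 1 := ⟨n - 1, by omega⟩
  rw [(main_formula f h t₀ (p + 1) hf hf' hh p le_rfl).self_of_nhds]
  refine Finset.sum_congr rfl fun k _ => ?_
  rw [qSum_eq]
end

section
/- For smooth functions f, g : ℝ → ℝ and all integers n ≥ 1 and k, the quantities P_{n,k} satisfy the recurrence P_{n+1,k}(t) = P'_{n,k}(t) + (n+k−1)·f''(t)·P_{n,k−1}(t), where P'_{n,k} denotes the derivative of the function t ↦ P_{n,k}(t). -/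
structure IsV {α : Type*} [DecidableEq α] (p : α → Prop) (S : Finset α) (j : ℕ)
    (P : Finset (Finset α)) : Prop where
  ne : ∀ B ∈ P, B.Nonempty
  sub : ∀ B ∈ P, ∀ x ∈ B, x ∈ S
  cov : ∀ x ∈ S, ∃ B ∈ P, x ∈ B
  dis : ∀ B ∈ P, ∀ C ∈ P, ∀ x, x ∈ B → x ∈ C → B = C
  crd : P.card = j
  sing : ∀ B ∈ P, ∀ x, B = {x} → p x

section
variable {α : Type*} [DecidableEq α] {p : α → Prop} {S : Finset α} {j : ℕ}
  {P : Finset (Finset α)} {a : α}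

theorem IsV.ins (h : IsV p S j P) (ha : a ∉ S) {B : Finset α} (hB : B ∈ P) :
    IsV p (insert a S) j (insert (insert a B) (P.erase B)) := by
  obtain ⟨h1, h2, h3, h4, h5, h6⟩ := h
  have hn : insert a B ∉ P.erase B := by
    intro h
    exact ha (h2 _ (Finset.mem_of_mem_erase h) a (by simp))
  refine ⟨?_, ?_, ?_, ?_, ?_, ?_⟩
  · grind
  · grind
  · intro x hx
    by_cases hxa : x = a
    · exact ⟨insert a B, by simp, by simp [hxa]⟩
    · obtain ⟨C, hC, hxC⟩ := h3 x (by grind)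
      by_cases hCB : C = B
      · exact ⟨insert a B, by simp, by grind⟩
      · exact ⟨C, by grind, hxC⟩
  · grind
  · rw [Finset.card_insert_of_notMem hn, Finset.card_erase_of_mem hB]
    have := Finset.card_pos.mpr ⟨B, hB⟩
    omega
  · intro C hC x hx
    obtain ⟨y, hy⟩ := h1 B hB
    have := h2 B hB y hy
    grind

theorem IsV.ins_not (h : IsV p S j P) (ha : a ∉ S) {B : Finset α} (hB : B ∈ P) :
    ¬ ∃ x ∈ S, ¬ p x ∧ {a, x} ∈ insert (insert a B) (P.erase B) := by
  obtain ⟨h1, h2, h3, h4, h5, h6⟩ := h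
  rintro ⟨x, hx, hpx, hm⟩
  rcases Finset.mem_insert.1 hm with hm | hm
  · refine hpx (h6 B hB x ?_)
    have haB : a ∉ B := fun h => ha (h2 _ hB _ h)
    ext y
    have := Finset.ext_iff.1 hm y
    grind
  · exact ha (h2 _ (Finset.mem_of_mem_erase hm) a (by simp))

theorem IsV.pair (x : α) (hx : x ∈ S) (h : IsV p (S.erase x) j P) (ha : a ∉ S) :
    IsV p (insert a S) (j+1) (insert {a, x} P) := by
  obtain ⟨h1, h2, h3, h4, h5, h6⟩ := h
  have hn : {a, x} ∉ P := by
    intro h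
    have := (h2 _ h a (by simp))
    grind
  have hax : a ≠ x := by rintro rfl; exact ha hx
  refine ⟨?_, ?_, ?_, ?_, ?_, ?_⟩
  · grind
  · grind
  · intro y hy
    by_cases hya : y = a ∨ y = x
    · exact ⟨{a,x}, by simp, by simpa using hya⟩
    · obtain ⟨C, hC, hxC⟩ := h3 y (by grind)
      exact ⟨C, by grind, hxC⟩
  · grind
  · rw [Finset.card_insert_of_notMem hn, h5]
  · intro C hC y hy
    grind

theorem IsV.unpair (x : α) (hx : x ∈ S) (h : IsV p (insert a S) (j+1) P) (ha : a ∉ S)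
    (hm : {a, x} ∈ P) : IsV p (S.erase x) j (P.erase {a, x}) := by
  obtain ⟨h1, h2, h3, h4, h5, h6⟩ := h
  have hax : a ≠ x := by rintro rfl; exact ha hx
  refine ⟨?_, ?_, ?_, ?_, ?_, ?_⟩
  · grind
  · intro B hB y hy
    have := h2 B (by grind) y hy
    have := h4 B (by grind) _ hm y hy
    grind
  · intro y hy
    obtain ⟨C, hC, hxC⟩ := h3 y (by grind)
    exact ⟨C, by grind, hxC⟩
  · grind
  · rw [Finset.card_erase_of_mem hm, h5]; rfl
  · grind

theorem IsV.del (h : IsV p (insert a S) j P) (ha : a ∉ S) (hpa : ¬ p a) {B : Finset α} (hB : B ∈ P)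
    (haB : a ∈ B) (hc : ¬ ∃ x ∈ S, ¬ p x ∧ {a, x} ∈ P) :
    IsV p S j (insert (B.erase a) (P.erase B)) := by
  obtain ⟨h1, h2, h3, h4, h5, h6⟩ := h
  have hne : (B.erase a).Nonempty := by
    by_contra hne
    have : B = {a} := by
      rw [Finset.not_nonempty_iff_eq_empty] at hne
      ext y
      have := Finset.ext_iff.1 hne y
      grind
    exact hpa (h6 B hB a this)
  have hn : B.erase a ∉ P.erase B := by
    intro h
    obtain ⟨y, hy⟩ := hne
    have := h4 B hB (B.erase a) (by grind) y (by grind) hy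
    grind
  refine ⟨?_, ?_, ?_, ?_, ?_, ?_⟩
  · grind
  · intro C hC y hy
    rcases Finset.mem_insert.1 hC with rfl | hC
    · have := h2 B hB y (by grind)
      grind
    · have := h2 C (by grind) y hy
      have := h4 C (by grind) B hB y hy
      grind
  · intro x hx
    obtain ⟨C, hC, hxC⟩ := h3 x (by grind)
    by_cases hCB : C = B
    · exact ⟨B.erase a, by simp, by grind⟩
    · exact ⟨C, by grind, hxC⟩
  · grind
  · rw [Finset.card_insert_of_notMem hn, Finset.card_erase_of_mem hB]
    have := Finset.card_pos.mpr ⟨B, hB⟩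
    omega
  · intro C hC x hx
    rcases Finset.mem_insert.1 hC with rfl | hC
    · by_contra hpx
      refine hc ⟨x, ?_, hpx, ?_⟩
      · have : x ∈ B.erase a := by rw [hx]; simp
        have := h2 B hB x (by grind)
        grind
      · have : B = {a, x} := by rw [← hx, Finset.insert_erase haB]
        rwa [← this]
    · exact h6 C (by grind) x hx

open scoped Classical in
noncomputable def VV [Fintype α] (p : α → Prop) (S : Finset α) (j : ℕ) : Finset (Finset (Finset α)) :=
  Finset.univ.filter (IsV p S j)

theorem mem_VV [Fintype α] : P ∈ VV p S j ↔ IsV p S j P := by simp [VV]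

open scoped Classical in
theorem VV_rec [Fintype α] (w : Finset α → ℝ) (ha : a ∉ S) (hpa : ¬ p a) :
    ∑ P ∈ VV p (insert a S) (j+1), ∏ B ∈ P, w B =
      ∑ P ∈ VV p S (j+1), ∑ B ∈ P, w (insert a B) * ∏ C ∈ P.erase B, w C
      + ∑ x ∈ S.filter (fun x => ¬ p x), ∑ P ∈ VV p (S.erase x) j, w {a, x} * ∏ B ∈ P, w B := by
  rw [← Finset.sum_filter_not_add_sum_filter _ (fun P => ∃ x ∈ S, ¬ p x ∧ {a, x} ∈ P)]
  congr 1
  · rw [Finset.sum_sigma']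
    symm
    refine Finset.sum_bij (fun y _ => insert (insert a y.2) (y.1.erase y.2)) ?_ ?_ ?_ ?_
    · rintro ⟨P, B⟩ h
      simp only [Finset.mem_sigma, mem_VV, Finset.mem_filter] at h ⊢
      exact ⟨h.1.ins ha h.2, h.1.ins_not ha h.2⟩
    · rintro ⟨P, B⟩ h ⟨P', B'⟩ h' he
      simp only [Finset.mem_sigma, mem_VV] at h h' he
      obtain ⟨h, hB⟩ := h
      obtain ⟨h', hB'⟩ := h'
      have e1 : ∀ C ∈ P, a ∉ C := fun C hC haC => ha (h.sub C hC a haC)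
      have e2 : ∀ C ∈ P', a ∉ C := fun C hC haC => ha (h'.sub C hC a haC)
      have hb : insert a B = insert a B' := by
        have : insert a B ∈ insert (insert a B') (P'.erase B') := by rw [← he]; simp
        rcases Finset.mem_insert.1 this with h | h
        · exact h
        · exact absurd (Finset.mem_insert_self a B) (e2 _ (Finset.mem_of_mem_erase h))
      have hBB : B = B' := by
        rw [← Finset.erase_insert (e1 B hB), hb, Finset.erase_insert (e2 B' hB')]
      subst hBB
      have : P = P' := by
        have n1 : insert a B ∉ P.erase B := fun h => e1 _ (Finset.mem_of_mem_erase h) (by simp)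
        have n2 : insert a B ∉ P'.erase B := fun h => e2 _ (Finset.mem_of_mem_erase h) (by simp)
        have : P.erase B = P'.erase B := by
          rw [← Finset.erase_insert n1, he, Finset.erase_insert n2]
        rw [← Finset.insert_erase hB, this, Finset.insert_erase hB']
      subst this
      rfl
    · intro P hP
      simp only [mem_VV, Finset.mem_filter] at hP
      obtain ⟨h, hc⟩ := hP
      obtain ⟨B, hB, haB⟩ := h.cov a (by simp)
      have h' := h.del ha hpa hB haB hc
      refine ⟨⟨insert (B.erase a) (P.erase B), B.erase a⟩, ?_, ?_⟩
      · simp only [Finset.mem_sigma, mem_VV]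
        exact ⟨h', by simp⟩
      · have hn : B.erase a ∉ P.erase B := by
          intro hm
          obtain ⟨y, hy⟩ := h'.ne (B.erase a) (by simp)
          have := h.dis B hB (B.erase a) (by grind) y (by grind) hy
          grind
        simp only
        rw [Finset.insert_erase haB, Finset.erase_insert hn, Finset.insert_erase hB]
    · rintro ⟨P, B⟩ h
      simp only [Finset.mem_sigma, mem_VV] at h ⊢
      rw [Finset.prod_insert]
      intro hm
      exact ha (h.1.sub _ (Finset.mem_of_mem_erase hm) a (by simp))
  · rw [Finset.sum_sigma']
    symm
    refine Finset.sum_bij (fun y _ => insert {a, y.1} y.2) ?_ ?_ ?_ ?_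
    · rintro ⟨x, P⟩ h
      simp only [Finset.mem_sigma, mem_VV, Finset.mem_filter] at h ⊢
      exact ⟨h.2.pair x h.1.1 ha, x, h.1.1, h.1.2, by simp⟩
    · rintro ⟨x, P⟩ h ⟨x', P'⟩ h' he
      simp only [Finset.mem_sigma, mem_VV, Finset.mem_filter] at h h' he
      have e1 : ∀ C ∈ P, a ∉ C := fun C hC haC => ha (Finset.mem_of_mem_erase (h.2.sub C hC a haC))
      have e2 : ∀ C ∈ P', a ∉ C := fun C hC haC => ha (Finset.mem_of_mem_erase (h'.2.sub C hC a haC))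
      have hb : ({a, x} : Finset α) = {a, x'} := by
        have : {a, x} ∈ insert {a, x'} P' := by rw [← he]; simp
        rcases Finset.mem_insert.1 this with h | h
        · exact h
        · exact absurd (Finset.mem_insert_self a _) (e2 _ h)
      have hx : x = x' := by
        have := Finset.ext_iff.1 hb x
        grind
      subst hx
      have : P = P' := by
        have n1 : {a, x} ∉ P := fun h => e1 _ h (by simp)
        have n2 : {a, x} ∉ P' := fun h => e2 _ h (by simp)
        rw [← Finset.erase_insert n1, he, Finset.erase_insert n2]
      subst this
      rfl
    · intro P hP
      simp only [mem_VV, Finset.mem_filter] at hP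
      obtain ⟨h, x, hx, hpx, hm⟩ := hP
      refine ⟨⟨x, P.erase {a, x}⟩, ?_, ?_⟩
      · simp only [Finset.mem_sigma, mem_VV, Finset.mem_filter]
        exact ⟨⟨hx, hpx⟩, h.unpair x hx ha hm⟩
      · exact Finset.insert_erase hm
    · rintro ⟨x, P⟩ h
      simp only [Finset.mem_sigma, mem_VV, Finset.mem_filter] at h ⊢
      rw [Finset.prod_insert]
      intro hm
      exact ha (Finset.mem_of_mem_erase (h.2.sub _ hm a (by simp)))

theorem isV_map {β : Type*} [DecidableEq β] (e : α ↪ β) {q : β → Prop} (hpq : ∀ x, q (e x) ↔ p x) :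
    IsV q (S.map e) j (P.map (Finset.mapEmbedding e).toEmbedding) ↔ IsV p S j P := by
  constructor
  · rintro ⟨h1, h2, h3, h4, h5, h6⟩
    simp only [Finset.mem_map, RelEmbedding.coe_toEmbedding, Finset.mapEmbedding_apply,
      forall_exists_index, and_imp, forall_apply_eq_imp_iff₂, Finset.map_nonempty,
      Finset.card_map] at h1 h2 h3 h4 h5 h6
    refine ⟨h1, ?_, ?_, ?_, h5, ?_⟩
    · intro B hB x hx
      obtain ⟨y, hy, hxy⟩ := h2 B hB x hx
      rwa [← e.injective hxy]
    · intro x hx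
      obtain ⟨_, ⟨B, hB, rfl⟩, hm⟩ := h3 x hx
      exact ⟨B, hB, by simpa using hm⟩
    · intro B hB C hC x hx hx'
      exact Finset.map_injective e (h4 B hB C hC x hx x hx' rfl)
    · rintro B hB x rfl
      exact (hpq x).1 (h6 _ hB (e x) (by simp))
  · rintro ⟨h1, h2, h3, h4, h5, h6⟩
    refine ⟨?_, ?_, ?_, ?_, ?_, ?_⟩ <;>
    simp only [Finset.mem_map, RelEmbedding.coe_toEmbedding, Finset.mapEmbedding_apply,
      forall_exists_index, and_imp, forall_apply_eq_imp_iff₂, Finset.map_nonempty,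
      Finset.card_map]
    · exact h1
    · intro B hB x hx
      exact ⟨x, h2 B hB x hx, rfl⟩
    · intro x hx
      obtain ⟨B, hB, hm⟩ := h3 x hx
      exact ⟨_, ⟨B, hB, rfl⟩, by simpa using hm⟩
    · rintro B hB C hC x hx x' hx' he
      rw [e.injective he] at hx'
      rw [h4 B hB C hC x hx hx']
    · exact h5
    · intro B hB x hx
      have : x ∈ B.map e := by rw [hx]; simp
      obtain ⟨y, hy, rfl⟩ := Finset.mem_map.1 this
      rw [hpq]
      refine h6 B hB y (Finset.map_injective e (by simpa using hx))

theorem VV_map [Fintype α] {β : Type*} [DecidableEq β] [Fintype β] (e : α ↪ β) {q : β → Prop}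
    (hpq : ∀ x, q (e x) ↔ p x) (w : Finset α → ℝ) (w' : Finset β → ℝ)
    (hw : ∀ B, w' (B.map e) = w B) :
    ∑ P ∈ VV q (S.map e) j, ∏ B ∈ P, w' B = ∑ P ∈ VV p S j, ∏ B ∈ P, w B := by
  symm
  refine Finset.sum_bij (fun P _ => P.map (Finset.mapEmbedding e).toEmbedding) ?_ ?_ ?_ ?_
  · intro P hP
    rw [mem_VV] at *
    exact (isV_map e hpq).2 hP
  · intro P _ P' _ h
    exact Finset.map_injective _ h
  · intro Q hQ
    rw [mem_VV] at hQ
    have : Q ⊆ (Finset.univ : Finset (Finset α)).map (Finset.mapEmbedding e).toEmbedding := by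
      intro B hB
      have : B ⊆ S.map e := hQ.sub B hB
      obtain ⟨C, _, rfl⟩ := Finset.subset_map_iff.1 this
      simp
    obtain ⟨P, _, rfl⟩ := Finset.subset_map_iff.1 this
    exact ⟨P, mem_VV.2 ((isV_map e hpq).1 hQ), rfl⟩
  · intro P _
    simp [hw]

end

open scoped Classical in
noncomputable def wt (f g : ℝ → ℝ) (t : ℝ) {m : ℕ} (B : Finset (Fin m)) : ℝ :=
  if ∃ x ∈ B, (x : ℕ) = 0 then iteratedDeriv B.card g t else iteratedDeriv B.card f t

noncomputable def pS (f g : ℝ → ℝ) (m j : ℕ) (t : ℝ) : ℝ :=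
  ∑ P ∈ VV (fun x : Fin m => (x : ℕ) = 0) Finset.univ j, ∏ B ∈ P, wt f g t B

theorem pSum_eq (f g : ℝ → ℝ) (n k : ℕ) (t : ℝ) :
    pSum f g n (k : ℤ) t = pS f g (n + k) (k + 1) t := by
  unfold pSum pS
  rw [if_neg (by omega)]
  simp only [Int.toNat_natCast]
  refine Finset.sum_congr ?_ fun P _ => rfl
  ext P
  rw [mem_VV]
  simp only [Finset.mem_filter, Finset.mem_univ, true_and]
  constructor
  · rintro ⟨h1, h2, h3, h4⟩
    refine ⟨h1, by simp, ?_, ?_, h3, ?_⟩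
    · intro x _
      obtain ⟨B, hB, _⟩ := h2 x
      exact ⟨B, hB⟩
    · intro B hB C hC x hx hx'
      exact (h2 x).unique ⟨hB, hx⟩ ⟨hC, hx'⟩
    · rintro B hB x rfl
      simpa using h4 _ hB (by simp)
  · rintro ⟨h1, h2, h3, h4, h5, h6⟩
    refine ⟨h1, ?_, h5, ?_⟩
    · intro x
      obtain ⟨B, hB, hx⟩ := h3 x (by simp)
      exact ⟨B, ⟨hB, hx⟩, fun C hC => h4 _ hC.1 _ hB x hC.2 hx⟩
    · intro B hB hc
      obtain ⟨x, rfl⟩ := Finset.card_eq_one.1 hc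
      exact ⟨x, by simp, h6 _ hB x rfl⟩

theorem wt_map (f g : ℝ → ℝ) (t : ℝ) {m m' : ℕ} (e : Fin m ↪ Fin m')
    (he : ∀ x, (e x : ℕ) = 0 ↔ (x : ℕ) = 0) (B : Finset (Fin m)) :
    wt f g t (B.map e) = wt f g t B := by
  simp [wt, he]

theorem hasDerivAt_iter {f : ℝ → ℝ} (hf : ContDiff ℝ (⊤ : ℕ∞) f) (i : ℕ) (t : ℝ) :
    HasDerivAt (fun s => iteratedDeriv i f s) (iteratedDeriv (i + 1) f t) t := by
  rw [iteratedDeriv_succ]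
  exact ((hf.differentiable_iteratedDeriv i (by exact_mod_cast WithTop.coe_lt_top _)) t).hasDerivAt

theorem wt_deriv {f g : ℝ → ℝ} (hf : ContDiff ℝ (⊤ : ℕ∞) f) (hg : ContDiff ℝ (⊤ : ℕ∞) g)
    (t : ℝ) {m : ℕ} (B : Finset (Fin m)) (a : Fin m) (ha : a ∉ B) (h0 : (a : ℕ) ≠ 0) :
    HasDerivAt (fun s => wt f g s B) (wt f g t (insert a B)) t := by
  unfold wt
  rw [Finset.card_insert_of_notMem ha]
  by_cases h : ∃ x ∈ B, (x : ℕ) = 0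
  · have h' : ∃ x ∈ insert a B, (x : ℕ) = 0 := by
      obtain ⟨x, hx, hx0⟩ := h
      exact ⟨x, by simp [hx], hx0⟩
    simp only [if_pos h, if_pos h']
    exact hasDerivAt_iter hg _ t
  · have h' : ¬ ∃ x ∈ insert a B, (x : ℕ) = 0 := by
      rintro ⟨x, hx, hx0⟩
      rcases Finset.mem_insert.1 hx with rfl | hx
      · exact h0 hx0
      · exact h ⟨x, hx, hx0⟩
    simp only [if_neg h, if_neg h']
    exact hasDerivAt_iter hf _ t

theorem pS_rec {f g : ℝ → ℝ} (hf : ContDiff ℝ (⊤ : ℕ∞) f) (hg : ContDiff ℝ (⊤ : ℕ∞) g)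
    (q j : ℕ) (t : ℝ) :
    pS f g (q + 2) (j + 1) t = deriv (fun s => pS f g (q + 1) (j + 1) s) t
      + q * iteratedDeriv 2 f t * pS f g q j t := by
  classical
  set S : Finset (Fin (q + 2)) := Finset.univ.map Fin.castSuccEmb with hS
  have hmS : ∀ x : Fin (q + 2), x ∈ S ↔ x ≠ Fin.last _ := by
    intro x
    simp only [hS, Finset.mem_map, Finset.mem_univ, true_and]
    exact Fin.exists_castSucc_eq
  have hu : (Finset.univ : Finset (Fin (q + 2))) = insert (Fin.last _) S := by
    ext x
    simp only [Finset.mem_univ, Finset.mem_insert, hmS, true_iff]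
    exact em _
  have hl : Fin.last (q + 1) ∉ S := by simp [hmS]
  have hcs : (fun s => pS f g (q + 1) (j + 1) s) = fun s =>
      ∑ P ∈ VV (fun x : Fin (q + 2) => (x : ℕ) = 0) S (j + 1), ∏ B ∈ P, wt f g s B := by
    funext s
    unfold pS
    symm
    exact VV_map Fin.castSuccEmb (by simp) _ _ (wt_map f g s _ (by simp))
  rw [hcs]
  have hd : HasDerivAt (fun s =>
      ∑ P ∈ VV (fun x : Fin (q + 2) => (x : ℕ) = 0) S (j + 1), ∏ B ∈ P, wt f g s B)
      (∑ P ∈ VV (fun x : Fin (q + 2) => (x : ℕ) = 0) S (j + 1), ∑ B ∈ P,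
        wt f g t (insert (Fin.last _) B) * ∏ C ∈ P.erase B, wt f g t C) t := by
    refine HasDerivAt.fun_sum fun P hP => ?_
    have := HasDerivAt.fun_finsetProd (u := P) (f := fun B s => wt f g s B)
      (f' := fun B => wt f g t (insert (Fin.last _) B)) (x := t) (fun B hB =>
        wt_deriv hf hg t B (Fin.last _)
          (fun h => hl ((mem_VV.1 hP).sub B hB _ h)) (by simp))
    refine this.congr_deriv (Finset.sum_congr rfl fun B _ => ?_)
    rw [smul_eq_mul, mul_comm]
  rw [hd.deriv]
  unfold pS
  rw [hu, VV_rec _ hl (by simp)]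
  congr 1
  have hx : ∀ x ∈ S.filter (fun x : Fin (q + 2) => ¬ (x : ℕ) = 0),
      ∑ P ∈ VV (fun x : Fin (q + 2) => (x : ℕ) = 0) (S.erase x) j,
        wt f g t {Fin.last _, x} * ∏ B ∈ P, wt f g t B
      = iteratedDeriv 2 f t * pS f g q j t := by
    intro x hx
    obtain ⟨hxS, hx0⟩ := Finset.mem_filter.1 hx
    have hxl := (hmS x).1 hxS
    obtain ⟨y, rfl⟩ := Fin.exists_castSucc_eq.2 hxl
    rw [← Finset.mul_sum]
    congr 1
    · unfold wt
      rw [if_neg, Finset.card_pair (Ne.symm hxl)]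
      rintro ⟨z, hz, hz0⟩
      simp only [Finset.mem_insert, Finset.mem_singleton] at hz
      rcases hz with rfl | rfl
      · simp at hz0
      · exact hx0 hz0
    · have he : S.erase y.castSucc
          = Finset.univ.map (y.succAboveEmb.trans Fin.castSuccEmb) := by
        rw [← Finset.map_map]
        ext z
        simp only [Finset.mem_erase, hmS, Finset.mem_map, Finset.mem_univ, true_and]
        constructor
        · rintro ⟨h1, h2⟩
          obtain ⟨z, rfl⟩ := Fin.exists_castSucc_eq.2 h2
          obtain ⟨v, hv⟩ := Fin.exists_succAbove_eq (x := z) (y := y) (by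
            rintro rfl; exact h1 rfl)
          exact ⟨z, ⟨v, hv⟩, rfl⟩
        · rintro ⟨_, ⟨v, rfl⟩, rfl⟩
          refine ⟨?_, Fin.castSucc_ne_last _⟩
          intro h
          exact Fin.succAbove_ne y v (Fin.castSucc_injective _ h)
      have h0 : ∀ v : Fin q, (((y.succAboveEmb.trans Fin.castSuccEmb) v : Fin (q + 2)) : ℕ) = 0
          ↔ (v : ℕ) = 0 := by
        intro v
        have : (y : ℕ) ≠ 0 := by simpa using hx0
        simp only [Function.Embedding.trans_apply, Fin.coe_succAboveEmb, Fin.coe_castSuccEmb,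
          Fin.val_castSucc, Fin.succAbove, Fin.lt_def]
        split_ifs with h
        · simp
        · simp at h ⊢; omega
      rw [he]
      exact VV_map _ h0 _ _ (wt_map f g t _ h0)
  refine (Finset.sum_congr (by ext; simp) hx).trans ?_
  rw [Finset.sum_const, nsmul_eq_mul, mul_assoc]
  congr 2
  have : S.filter (fun x : Fin (q + 2) => ¬ (x : ℕ) = 0) = (Finset.univ.erase 0).map Fin.castSuccEmb := by
    ext z
    simp only [Finset.mem_filter, hmS, Finset.mem_map, Finset.mem_erase, Finset.mem_univ, and_true]
    constructor
    · rintro ⟨h1, h2⟩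
      obtain ⟨z, rfl⟩ := Fin.exists_castSucc_eq.2 h1
      exact ⟨z, by rintro rfl; simp at h2, rfl⟩
    · rintro ⟨v, h, rfl⟩
      refine ⟨Fin.castSucc_ne_last _, ?_⟩
      intro h0
      exact h (Fin.ext h0)
  rw [this, Finset.card_map, Finset.card_erase_of_mem (by simp)]
  simp

theorem pS_zero (f g : ℝ → ℝ) (q : ℕ) (t : ℝ) : (q : ℝ) * pS f g q 0 t = 0 := by
  rcases q with _ | q
  · simp
  · have : VV (fun x : Fin (q + 1) => (x : ℕ) = 0) Finset.univ 0 = ∅ := by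
      refine Finset.eq_empty_of_forall_notMem fun P hP => ?_
      rw [mem_VV] at hP
      obtain ⟨B, hB, _⟩ := hP.cov 0 (by simp)
      rw [Finset.card_eq_zero.1 hP.crd] at hB
      simp at hB
    rw [pS, this, Finset.sum_empty, mul_zero]

/-- **Recurrence for `P_{n,k}`:**
`P_{n+1,k}(t) = P'_{n,k}(t) + (n+k−1)·f''(t)·P_{n,k−1}(t)` for all integers
`n ≥ 1` and `k`, for smooth `f, g`. -/
theorem pSum_recurrence (f g : ℝ → ℝ) (hf : ContDiff ℝ (⊤ : ℕ∞) f) (hg : ContDiff ℝ (⊤ : ℕ∞) g)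
    (n : ℕ) (hn : 1 ≤ n) (k : ℤ) (t : ℝ) :
    pSum f g (n + 1) k t =
      deriv (fun s => pSum f g n k s) t
        + ((n : ℝ) + (k : ℝ) - 1) * iteratedDeriv 2 f t * pSum f g n (k - 1) t := by
  by_cases hk : k < 0
  · have hk' : k - 1 < 0 := by omega
    simp [pSum, hk, hk']
  obtain ⟨k, rfl⟩ := Int.eq_ofNat_of_zero_le (not_lt.1 hk)
  obtain ⟨n, rfl⟩ : ∃ m, n = m + 1 := ⟨n - 1, by omega⟩
  have hrec := pS_rec hf hg (n + k) k t
  simp only [pSum_eq]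
  rw [show n + 1 + 1 + k = n + k + 2 by ring, show n + 1 + k = n + k + 1 by ring, hrec]
  congr 1
  rcases k with _ | k
  · have h1 : pSum f g (n + 1) (((0 : ℕ) : ℤ) - 1) t = 0 := by simp [pSum]
    have h2 := pS_zero f g (n + 0) t
    rw [h1, mul_right_comm, h2]
    simp
  · rw [show (((k + 1 : ℕ) : ℤ) - 1) = (k : ℤ) by push_cast; ring, pSum_eq,
      show n + 1 + k = n + (k + 1) by ring]
    push_cast
    ring
end

section
/- For smooth functions f, g : ℝ → ℝ and every integer n ≥ 1, P_{n,n−1}(t) = 1·3·5⋯(2n−3) · g'(t) · [f''(t)]^(n−1) for all t, where 1·3·5⋯(2n−3) denotes the double factorial (2n−3)!! (interpreted as 1 when n = 1). -/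
open scoped Classical in
noncomputable def pmMatch {α : Type*} [DecidableEq α] (S : Finset α) : Finset (Finset (Finset α)) :=
  S.powerset.powerset.filter (fun P => (∀ B ∈ P, B.card = 2) ∧ ∀ x ∈ S, ∃! B, B ∈ P ∧ x ∈ B)

theorem mem_pmMatch {α : Type*} [DecidableEq α] (S : Finset α) (P : Finset (Finset α)) :
    P ∈ pmMatch S ↔ (∀ B ∈ P, B ⊆ S) ∧ (∀ B ∈ P, B.card = 2) ∧
      (∀ x ∈ S, ∃ B ∈ P, x ∈ B) ∧ (∀ x, ∀ B ∈ P, ∀ C ∈ P, x ∈ B → x ∈ C → B = C) := by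
  unfold pmMatch
  simp only [Finset.mem_filter, Finset.mem_powerset]
  constructor
  · rintro ⟨h1, h2, h3⟩
    have h1' : ∀ B ∈ P, B ⊆ S := fun B hB => Finset.mem_powerset.1 (h1 hB)
    refine ⟨h1', h2, ?_, ?_⟩
    · intro x hx
      obtain ⟨B, hB, -⟩ := h3 x hx
      exact ⟨B, hB⟩
    · intro x B hB C hC hxB hxC
      exact (h3 x (h1' B hB hxB)).unique ⟨hB, hxB⟩ ⟨hC, hxC⟩
  · rintro ⟨h1, h2, h3, h4⟩
    refine ⟨fun B hB => Finset.mem_powerset.2 (h1 B hB), h2, ?_⟩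
    intro x hx
    obtain ⟨B, hB, hxB⟩ := h3 x hx
    exact ⟨B, ⟨hB, hxB⟩, fun C hC => h4 x C hC.1 B hB hC.2 hxB⟩

theorem pmMatch_rec {α : Type*} [DecidableEq α] (S : Finset α) (a : α) (ha : a ∈ S) :
    pmMatch S = (S.erase a).biUnion
      (fun b => (pmMatch ((S.erase a).erase b)).image (insert {a, b})) := by
  ext P
  simp only [Finset.mem_biUnion, Finset.mem_image]
  constructor
  · intro hP
    obtain ⟨h1, h2, h3, h4⟩ := (mem_pmMatch _ _).1 hP
    obtain ⟨B, hB, haB⟩ := h3 a ha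
    obtain ⟨b, hb⟩ : ∃ b, B = {a, b} ∧ a ≠ b := by
      obtain ⟨x, y, hxy, rfl⟩ := Finset.card_eq_two.1 (h2 B hB)
      simp only [Finset.mem_insert, Finset.mem_singleton] at haB
      rcases haB with rfl | rfl
      · exact ⟨y, rfl, hxy⟩
      · exact ⟨x, Finset.pair_comm _ _, hxy.symm⟩
    obtain ⟨rfl, hab⟩ := hb
    have hbS : b ∈ S := h1 _ hB (by simp)
    refine ⟨b, Finset.mem_erase.2 ⟨hab.symm, hbS⟩, P.erase {a, b}, ?_, Finset.insert_erase hB⟩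
    rw [mem_pmMatch]
    refine ⟨?_, fun C hC => h2 C (Finset.mem_of_mem_erase hC), ?_, ?_⟩
    · intro C hC x hx
      obtain ⟨hC1, hC2⟩ := Finset.mem_erase.1 hC
      simp only [Finset.mem_erase]
      refine ⟨?_, ?_, h1 C hC2 hx⟩
      · rintro rfl
        exact hC1 (h4 x C hC2 _ hB hx (by simp))
      · rintro rfl
        exact hC1 (h4 x C hC2 _ hB hx (by simp))
    · intro x hx
      simp only [Finset.mem_erase] at hx
      obtain ⟨C, hC, hxC⟩ := h3 x hx.2.2
      refine ⟨C, Finset.mem_erase.2 ⟨?_, hC⟩, hxC⟩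
      rintro rfl
      simp only [Finset.mem_insert, Finset.mem_singleton] at hxC
      tauto
    · intro x C hC D hD
      exact h4 x C (Finset.mem_of_mem_erase hC) D (Finset.mem_of_mem_erase hD)
  · rintro ⟨b, hb, Q, hQ, rfl⟩
    obtain ⟨h1, h2, h3, h4⟩ := (mem_pmMatch _ _).1 hQ
    obtain ⟨hba, hbS⟩ := Finset.mem_erase.1 hb
    have key : ∀ C ∈ Q, ∀ x ∈ C, x ≠ a ∧ x ≠ b := by
      intro C hC x hx
      have := h1 C hC hx
      simp only [Finset.mem_erase] at this
      tauto
    rw [mem_pmMatch]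
    refine ⟨?_, ?_, ?_, ?_⟩
    · intro B hB x hx
      rcases Finset.mem_insert.1 hB with rfl | hB
      · simp only [Finset.mem_insert, Finset.mem_singleton] at hx
        rcases hx with rfl | rfl <;> assumption
      · have := h1 B hB hx
        simp only [Finset.mem_erase] at this
        tauto
    · intro B hB
      rcases Finset.mem_insert.1 hB with rfl | hB
      · exact Finset.card_pair hba.symm
      · exact h2 B hB
    · intro x hx
      by_cases hxa : x = a
      · exact ⟨{a, b}, by simp, by simp [hxa]⟩
      by_cases hxb : x = b
      · exact ⟨{a, b}, by simp, by simp [hxb]⟩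
      obtain ⟨B, hB, hxB⟩ := h3 x (by simp [hxa, hxb, hx])
      exact ⟨B, by simp [hB], hxB⟩
    · intro x B hB C hC hxB hxC
      rcases Finset.mem_insert.1 hB with rfl | hB <;> rcases Finset.mem_insert.1 hC with rfl | hC
      · rfl
      · have := key C hC x hxC
        simp only [Finset.mem_insert, Finset.mem_singleton] at hxB
        tauto
      · have := key B hB x hxB
        simp only [Finset.mem_insert, Finset.mem_singleton] at hxC
        tauto
      · exact h4 x B hB C hC hxB hxC

theorem pmMatch_not_mem {α : Type*} [DecidableEq α] {S : Finset α} {Q : Finset (Finset α)}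
    (hQ : Q ∈ pmMatch S) {B : Finset α} {x : α} (hx : x ∈ B) (hxS : x ∉ S) : B ∉ Q :=
  fun hB => hxS (((mem_pmMatch _ _).1 hQ).1 B hB hx)

theorem card_pmMatch {α : Type*} [DecidableEq α] (m : ℕ) : ∀ (S : Finset α), S.card = 2 * m →
    (pmMatch S).card = Nat.doubleFactorial (2 * m - 1) := by
  induction m with
  | zero =>
    intro S hS
    have : S = ∅ := by simpa using hS
    subst this
    have : pmMatch (∅ : Finset α) = {∅} := by
      ext P
      rw [mem_pmMatch, Finset.mem_singleton]
      constructor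
      · rintro ⟨h1, h2, -, -⟩
        rw [Finset.eq_empty_iff_forall_notMem]
        intro B hB
        have h := h2 B hB
        rw [Finset.subset_empty.1 (h1 B hB)] at h
        simp at h
      · rintro rfl
        simp
    simp [this]
  | succ m ih =>
    intro S hS
    obtain ⟨a, ha⟩ : S.Nonempty := Finset.card_pos.1 (by omega)
    have hc : (S.erase a).card = 2 * m + 1 := by rw [Finset.card_erase_of_mem ha]; omega
    rw [pmMatch_rec S a ha, Finset.card_biUnion]
    · rw [Finset.sum_congr rfl (g := fun _ => Nat.doubleFactorial (2 * m - 1))]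
      · rw [Finset.sum_const, hc, smul_eq_mul]
        rcases m with _ | m
        · simp
        · have : 2 * (m + 1 + 1) - 1 = (2 * (m + 1) - 1) + 2 := by omega
          rw [this, Nat.doubleFactorial_add_two]
          congr 1
      · intro b hb
        rw [Finset.card_image_of_injOn, ih]
        · rw [Finset.card_erase_of_mem hb]; omega
        · intro Q hQ R hR h
          have h1 := pmMatch_not_mem (B := {a, b}) (x := a) hQ (by simp) (by simp)
          have h2 := pmMatch_not_mem (B := {a, b}) (x := a) hR (by simp) (by simp)
          rw [← Finset.erase_insert h1, ← Finset.erase_insert h2, h]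
    · intro b hb c hc hbc
      rw [Function.onFun, Finset.disjoint_left]
      intro P hP hP'
      obtain ⟨Q, hQ, rfl⟩ := Finset.mem_image.1 hP
      obtain ⟨R, hR, h⟩ := Finset.mem_image.1 hP'
      have h1 := pmMatch_not_mem (B := {a, c}) (x := a) hQ (by simp) (by simp)
      have h2 : ({a, c} : Finset α) ∈ insert {a, b} Q := by rw [← h]; simp
      rcases Finset.mem_insert.1 h2 with h2 | h2
      · have h3 : c ∈ ({a, b} : Finset α) := by rw [← h2]; simp
        simp only [Finset.mem_insert, Finset.mem_singleton] at h3
        rcases h3 with h3 | h3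
        · exact (Finset.mem_erase.1 hc).1 h3
        · exact hbc h3.symm
      · exact h1 h2

theorem part_struct {α : Type*} [DecidableEq α] [Fintype α] (z : α) (m : ℕ)
    (hα : Fintype.card α = 2 * m + 1) (P : Finset (Finset α))
    (h1 : ∀ B ∈ P, B.Nonempty) (h2 : ∀ x, ∃! B, B ∈ P ∧ x ∈ B)
    (h3 : P.card = m + 1) (h4 : ∀ B ∈ P, B.card = 1 → z ∈ B) :
    {z} ∈ P ∧ ∀ B ∈ P.erase {z}, B.card = 2 ∧ z ∉ B := by
  have hs : ∑ B ∈ P, B.card = 2 * m + 1 := by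
    rw [Finset.sum_card (n := 1), hα, mul_one]
    intro a
    rw [Finset.card_eq_one]
    obtain ⟨B, hB, hu⟩ := h2 a
    refine ⟨B, ?_⟩
    ext C
    simp only [Finset.mem_filter, Finset.mem_singleton]
    exact ⟨fun h => hu C h, fun h => h ▸ hB⟩
  obtain ⟨Z, ⟨hZ, hzZ⟩, hu⟩ := h2 z
  have hn : ∀ B ∈ P.erase Z, z ∉ B := fun B hB hz =>
    (Finset.mem_erase.1 hB).1 (hu B ⟨(Finset.mem_erase.1 hB).2, hz⟩)
  have hge : ∀ B ∈ P.erase Z, 2 ≤ B.card := by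
    intro B hB
    have := (h1 B (Finset.mem_of_mem_erase hB)).card_pos
    have h5 : B.card ≠ 1 := fun h => hn B hB (h4 B (Finset.mem_of_mem_erase hB) h)
    omega
  have hce : (P.erase Z).card = m := by rw [Finset.card_erase_of_mem hZ]; omega
  have hsum := Finset.add_sum_erase P (fun B => B.card) hZ
  have hle := Finset.sum_le_sum hge
  have hZp := (h1 Z hZ).card_pos
  simp only [Finset.sum_const, smul_eq_mul, hce] at hle
  simp only [hs] at hsum
  have hZ1 : Z.card = 1 := by omega
  have hZz : Z = {z} := by
    obtain ⟨w, rfl⟩ := Finset.card_eq_one.1 hZ1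
    simp only [Finset.mem_singleton] at hzZ
    rw [hzZ]
  subst hZz
  refine ⟨hZ, fun B hB => ⟨?_, hn B hB⟩⟩
  have := (Finset.sum_eq_sum_iff_of_le hge).1
    (by simp only [Finset.sum_const, smul_eq_mul, hce]; omega)
  exact (this B hB).symm

theorem part_card {α : Type*} [DecidableEq α] [Fintype α] (z : α) (m : ℕ)
    (hα : Fintype.card α = 2 * m + 1) (F : Finset (Finset (Finset α)))
    (hF : ∀ P, P ∈ F ↔ (∀ B ∈ P, B.Nonempty) ∧ (∀ x, ∃! B, B ∈ P ∧ x ∈ B) ∧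
      P.card = m + 1 ∧ ∀ B ∈ P, B.card = 1 → z ∈ B) :
    F.card = Nat.doubleFactorial (2 * m - 1) := by
  have hc : (Finset.univ.erase z).card = 2 * m := by
    rw [Finset.card_erase_of_mem (Finset.mem_univ z), Finset.card_univ, hα]; rfl
  rw [← card_pmMatch m (Finset.univ.erase z) hc]
  have hnz : ∀ Q ∈ pmMatch (Finset.univ.erase z), {z} ∉ Q := fun Q hQ =>
    pmMatch_not_mem (x := z) hQ (by simp) (by simp)
  have : F = (pmMatch (Finset.univ.erase z)).image (insert {z}) := by
    ext P
    rw [Finset.mem_image, hF]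
    constructor
    · rintro ⟨h1, h2, h3, h4⟩
      obtain ⟨hz, hB⟩ := part_struct z m hα P h1 h2 h3 h4
      refine ⟨P.erase {z}, ?_, Finset.insert_erase hz⟩
      rw [mem_pmMatch]
      refine ⟨?_, fun B h => (hB B h).1, ?_, ?_⟩
      · intro B h x hx
        simp only [Finset.mem_erase, Finset.mem_univ, and_true]
        rintro rfl
        exact (hB B h).2 hx
      · intro x hx
        obtain ⟨B, ⟨hBP, hxB⟩, -⟩ := h2 x
        refine ⟨B, Finset.mem_erase.2 ⟨?_, hBP⟩, hxB⟩
        rintro rfl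
        simp at hx hxB
        exact hx hxB
      · intro x B hB C hC hxB hxC
        exact (h2 x).unique ⟨Finset.mem_of_mem_erase hB, hxB⟩ ⟨Finset.mem_of_mem_erase hC, hxC⟩
    · rintro ⟨Q, hQ, rfl⟩
      have hzQ := hnz Q hQ
      obtain ⟨h1, h2, h3, h4⟩ := (mem_pmMatch _ _).1 hQ
      have hne : ∀ B ∈ Q, z ∉ B := fun B hB hz => by simpa using h1 B hB hz
      have huniq : ∀ x, ∃! B, B ∈ insert {z} Q ∧ x ∈ B := by
        intro x
        by_cases hx : x = z
        · subst hx
          refine ⟨{x}, by simp, ?_⟩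
          rintro B ⟨hB, hxB⟩
          rcases Finset.mem_insert.1 hB with h | h
          · exact h
          · exact absurd hxB (hne B h)
        · obtain ⟨B, hB, hxB⟩ := h3 x (by simp [hx])
          refine ⟨B, ⟨by simp [hB], hxB⟩, ?_⟩
          rintro C ⟨hC, hxC⟩
          rcases Finset.mem_insert.1 hC with h | h
          · subst h
            simp at hxC
            exact absurd hxC hx
          · exact h4 x C h B hB hxC hxB
      refine ⟨?_, huniq, ?_, ?_⟩
      · intro B hB
        rcases Finset.mem_insert.1 hB with rfl | h
        · simp
        · exact Finset.card_pos.1 (by rw [h2 B h]; norm_num)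
      · have hs : ∑ B ∈ insert {z} Q, B.card = 2 * m + 1 := by
          rw [Finset.sum_card (n := 1), hα, mul_one]
          intro a
          rw [Finset.card_eq_one]
          obtain ⟨B, hB, hu⟩ := huniq a
          refine ⟨B, ?_⟩
          ext C
          simp only [Finset.mem_filter, Finset.mem_singleton]
          exact ⟨fun h => hu C h, fun h => h ▸ hB⟩
        rw [Finset.sum_insert hzQ, Finset.sum_congr rfl h2, Finset.sum_const] at hs
        rw [Finset.card_insert_of_notMem hzQ]
        simp at hs
        omega
      · intro B hB hB1
        rcases Finset.mem_insert.1 hB with rfl | h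
        · simp
        · have := h2 B h
          omega
  rw [this, Finset.card_image_of_injOn]
  intro Q hQ R hR h
  rw [← Finset.erase_insert (hnz Q hQ), ← Finset.erase_insert (hnz R hR), h]

/-- For smooth `f, g` and every `n ≥ 1`,
`P_{n,n−1}(t) = 1·3·5⋯(2n−3) · g'(t) · [f''(t)]^(n−1)` for all `t`,
where `1·3·5⋯(2n−3)` is the double factorial `(2n−3)‼` (equal to `1` for `n = 1`). -/
theorem pSum_k_eq_n_sub_one (f g : ℝ → ℝ) (hf : ContDiff ℝ (⊤ : ℕ∞) f) (hg : ContDiff ℝ (⊤ : ℕ∞) g)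
    (n : ℕ) (hn : 1 ≤ n) (t : ℝ) :
    pSum f g n ((n : ℤ) - 1) t =
      (Nat.doubleFactorial (2 * n - 3) : ℝ) * deriv g t * (iteratedDeriv 2 f t) ^ (n - 1) := by
  classical
  obtain ⟨m, rfl⟩ : ∃ m, n = m + 1 := ⟨n - 1, by omega⟩
  have hk : (((m + 1 : ℕ) : ℤ) - 1) = (m : ℤ) := by push_cast; ring
  rw [hk]
  unfold pSum
  rw [if_neg (by omega)]
  have hα : Fintype.card (Fin (m + 1 + (m : ℤ).toNat)) = 2 * m + 1 := by
    simp only [Fintype.card_fin, Int.toNat_natCast]; omega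
  have hpos : 0 < m + 1 + (m : ℤ).toNat := by omega
  have hz : ∀ B : Finset (Fin (m + 1 + (m : ℤ).toNat)),
      (∃ x ∈ B, (x : ℕ) = 0) ↔ (⟨0, hpos⟩ : Fin (m + 1 + (m : ℤ).toNat)) ∈ B := by
    intro B
    constructor
    · rintro ⟨x, hx, h⟩
      have : x = ⟨0, hpos⟩ := Fin.ext h
      rwa [← this]
    · intro h
      exact ⟨_, h, rfl⟩
  have hm : 2 * (m + 1) - 3 = 2 * m - 1 := by omega
  rw [hm, ← part_card (⟨0, hpos⟩ : Fin (m + 1 + (m : ℤ).toNat)) m hα _ (fun P => ?_),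
    mul_assoc, ← nsmul_eq_mul]
  · refine Finset.sum_eq_card_nsmul ?_
    intro P hP
    obtain ⟨h1, h2, h3, h4⟩ := (Finset.mem_filter.1 hP).2
    obtain ⟨hzP, hB⟩ := part_struct (⟨0, hpos⟩ : Fin (m + 1 + (m : ℤ).toNat)) m hα P h1 h2
      (by simpa using h3) (fun B hB h => (hz B).1 (h4 B hB h))
    rw [← Finset.mul_prod_erase P _ hzP, if_pos ((hz _).2 (by simp)), Finset.card_singleton,
      iteratedDeriv_one]
    congr 1
    rw [Finset.prod_congr rfl (g := fun _ => iteratedDeriv 2 f t), Finset.prod_const,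
      Finset.card_erase_of_mem hzP, h3]
    · simp
    · intro B h
      rw [if_neg (fun h' => (hB B h).2 ((hz B).1 h')), (hB B h).1]
  · rw [Finset.mem_filter]
    simp only [hz, Finset.mem_univ, true_and]
    exact Iff.rfl
end

section
/- For smooth functions f, g : ℝ → ℝ and every integer n ≥ 2, P_{n,n−2}(t) = 1·3·5⋯(2n−3) · g''(t) · [f''(t)]^(n−2) + C(2n−3, 3) · 1·3·5⋯(2n−7) · g'(t) · [f''(t)]^(n−3) · f'''(t) for all t, where C(2n−3,3) is the binomial coefficient and the double-factorial products 1·3·5⋯(2n−3) and 1·3·5⋯(2n−7) are interpreted as 1 when empty (the second summand is interpreted as 0 when n = 2). -/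
open scoped Classical in
noncomputable def partsOf {α : Type*} [Fintype α] (S : Finset α) (k : ℕ) :
    Finset (Finset (Finset α)) :=
  Finset.univ.filter (fun p => (∀ B ∈ p, B ⊆ S) ∧ (∀ x ∈ S, ∃! B, B ∈ p ∧ x ∈ B) ∧ p.card = k)

noncomputable def tSum {α : Type*} [Fintype α] (v : Finset α → ℝ) (S : Finset α) (k : ℕ) : ℝ :=
  ∑ p ∈ partsOf S k, ∏ B ∈ p, v B

lemma mem_partsOf {α : Type*} [Fintype α] (S : Finset α) (k : ℕ) (p : Finset (Finset α)) :
    p ∈ partsOf S k ↔ (∀ B ∈ p, B ⊆ S) ∧ (∀ x ∈ S, ∃! B, B ∈ p ∧ x ∈ B) ∧ p.card = k := by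
  simp [partsOf]

lemma tSum_congr {α : Type*} [Fintype α] (v v' : Finset α → ℝ) (S : Finset α) (k : ℕ)
    (h : ∀ B ⊆ S, v B = v' B) : tSum v S k = tSum v' S k := by
  apply Finset.sum_congr rfl
  intro p hp
  apply Finset.prod_congr rfl
  intro B hB
  exact h B (((mem_partsOf S k p).1 hp).1 B hB)

lemma tSum_rec {α : Type*} [Fintype α] [DecidableEq α] (v : Finset α → ℝ) (S : Finset α) (k : ℕ) (a : α)
    (ha : a ∈ S) :
    tSum v S (k+1) = ∑ B ∈ S.powerset.filter (fun B => a ∈ B), v B * tSum v (S \ B) k := by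
  simp only [tSum, Finset.mul_sum]
  rw [Finset.sum_sigma']
  symm
  have key : ∀ (B : Finset α) (p : Finset (Finset α)), a ∈ B → p ∈ partsOf (S \ B) k → B ∉ p := by
    intro B p haB hp hB
    have := ((mem_partsOf _ _ _).1 hp).1 B hB haB
    simp [haB] at this
  refine Finset.sum_bij (fun x _ => insert x.1 x.2) ?_ ?_ ?_ ?_
  · rintro ⟨B, p⟩ h
    simp only [Finset.mem_sigma, Finset.mem_filter, Finset.mem_powerset] at h
    obtain ⟨⟨hBS, haB⟩, hp⟩ := h
    have hn := key B p haB hp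
    rw [mem_partsOf] at hp ⊢
    obtain ⟨h1, h2, h3⟩ := hp
    refine ⟨?_, ?_, ?_⟩
    · intro C hC
      rcases Finset.mem_insert.1 hC with rfl | hC
      · exact hBS
      · exact (h1 C hC).trans Finset.sdiff_subset
    · intro x hx
      by_cases hxB : x ∈ B
      · refine ⟨B, ⟨by simp, hxB⟩, ?_⟩
        rintro C ⟨hC, hxC⟩
        rcases Finset.mem_insert.1 hC with rfl | hC
        · rfl
        · have := h1 C hC hxC
          simp [hxB] at this
      · obtain ⟨C, ⟨hC, hxC⟩, hu⟩ := h2 x (by simp [hx, hxB])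
        refine ⟨C, ⟨by simp [hC], hxC⟩, ?_⟩
        rintro D ⟨hD, hxD⟩
        rcases Finset.mem_insert.1 hD with rfl | hD
        · exact absurd hxD hxB
        · exact hu D ⟨hD, hxD⟩
    · simp [Finset.card_insert_of_notMem hn, h3]
  · rintro ⟨B, p⟩ h ⟨B', p'⟩ h' heq
    simp only [Finset.mem_sigma, Finset.mem_filter, Finset.mem_powerset] at h h' heq
    obtain ⟨⟨hBS, haB⟩, hp⟩ := h
    obtain ⟨⟨hBS', haB'⟩, hp'⟩ := h'
    have hn := key B p haB hp
    have hn' := key B' p' haB' hp'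
    have hBB : B = B' := by
      have : B ∈ insert B' p' := heq ▸ Finset.mem_insert_self B p
      rcases Finset.mem_insert.1 this with h | h
      · exact h
      · have := ((mem_partsOf _ _ _).1 hp').1 B h haB
        simp [haB'] at this
    subst hBB
    have : p = p' := by
      rw [← Finset.erase_insert hn, heq, Finset.erase_insert hn']
    rw [this]
  · intro p hp
    rw [mem_partsOf] at hp
    obtain ⟨h1, h2, h3⟩ := hp
    obtain ⟨B, ⟨hB, haB⟩, hu⟩ := h2 a ha
    refine ⟨⟨B, p.erase B⟩, ?_, Finset.insert_erase hB⟩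
    simp only [Finset.mem_sigma, Finset.mem_filter, Finset.mem_powerset]
    refine ⟨⟨h1 B hB, haB⟩, ?_⟩
    rw [mem_partsOf]
    refine ⟨?_, ?_, ?_⟩
    · intro C hC x hxC
      have hC' := Finset.mem_erase.1 hC
      have hxS := h1 C hC'.2 hxC
      refine Finset.mem_sdiff.2 ⟨hxS, fun hxB => hC'.1 ?_⟩
      exact (h2 x hxS).unique ⟨hC'.2, hxC⟩ ⟨hB, hxB⟩
    · intro x hx
      have hx' := Finset.mem_sdiff.1 hx
      obtain ⟨C, ⟨hC, hxC⟩, hu⟩ := h2 x hx'.1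
      refine ⟨C, ⟨Finset.mem_erase.2 ⟨?_, hC⟩, hxC⟩, ?_⟩
      · rintro rfl
        exact hx'.2 hxC
      · rintro D ⟨hD, hxD⟩
        exact hu D ⟨(Finset.mem_erase.1 hD).2, hxD⟩
    · rw [Finset.card_erase_of_mem hB, h3]; rfl
  · rintro ⟨B, p⟩ h
    simp only [Finset.mem_sigma, Finset.mem_filter, Finset.mem_powerset] at h
    obtain ⟨⟨hBS, haB⟩, hp⟩ := h
    rw [Finset.prod_insert (key B p haB hp)]

lemma sum_blocks {α : Type*} [Fintype α] [DecidableEq α] (S : Finset α) (a : α) (ha : a ∈ S) (h : ℕ → ℝ) :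
    ∑ B ∈ S.powerset.filter (fun B => a ∈ B), h B.card
      = ∑ j ∈ Finset.range S.card, ((S.card - 1).choose j : ℝ) * h (j+1) := by
  have hc : S.card = (S.erase a).card + 1 := (Finset.card_erase_add_one ha).symm
  have := Finset.sum_powerset_apply_card (x := S.erase a) (fun j => h (j+1))
  simp only [nsmul_eq_mul] at this
  rw [hc, Nat.add_sub_cancel, ← this]
  refine Finset.sum_bij' (fun B _ => B.erase a) (fun C _ => insert a C) ?_ ?_ ?_ ?_ ?_
  · intro B hB
    simp only [Finset.mem_filter, Finset.mem_powerset] at hB ⊢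
    exact Finset.erase_subset_erase a hB.1
  · intro C hC
    simp only [Finset.mem_filter, Finset.mem_powerset] at hC ⊢
    refine ⟨Finset.insert_subset ha (hC.trans (Finset.erase_subset _ _)), by simp⟩
  · intro B hB
    exact Finset.insert_erase (Finset.mem_filter.1 hB).2
  · intro C hC
    apply Finset.erase_insert
    intro h
    have := Finset.mem_powerset.1 hC h
    simp at this
  · intro B hB
    rw [Finset.card_erase_add_one (Finset.mem_filter.1 hB).2]

noncomputable def wNum (w : ℕ → ℝ) : ℕ → ℕ → ℝ
  | 0, s => if s = 0 then 1 else 0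
  | (k+1), s => ∑ j ∈ Finset.range s, ((s - 1).choose j : ℝ) * (w (j+1) * wNum w k (s - (j+1)))

lemma tSum_card {α : Type*} [Fintype α] (w : ℕ → ℝ) (h0 : w 0 = 0) (k : ℕ) :
    ∀ S : Finset α, tSum (fun B => w B.card) S k = wNum w k S.card := by
  classical
  induction k with
  | zero =>
    intro S
    have : partsOf S 0 = if S.card = 0 then {∅} else ∅ := by
      ext p
      rw [mem_partsOf]
      split_ifs with h
      · rw [Finset.card_eq_zero] at h
        subst h
        simp only [Finset.card_eq_zero, Finset.mem_singleton]
        constructor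
        · exact fun h => h.2.2
        · rintro rfl; simp
      · simp only [Finset.card_eq_zero, Finset.notMem_empty, iff_false]
        rintro ⟨-, h2, rfl⟩
        obtain ⟨x, hx⟩ := Finset.card_pos.1 (Nat.pos_of_ne_zero h)
        obtain ⟨B, hB, -⟩ := h2 x hx
        simp at hB
    simp only [tSum, this, wNum]
    split_ifs <;> simp
  | succ k ih =>
    intro S
    rcases S.eq_empty_or_nonempty with rfl | ⟨a, ha⟩
    · simp only [wNum, tSum, Finset.card_empty, Finset.range_zero, Finset.sum_empty]
      apply Finset.sum_eq_zero
      intro p hp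
      rw [mem_partsOf] at hp
      obtain ⟨B, hB⟩ := Finset.card_pos.1 (by omega : 0 < p.card)
      apply Finset.prod_eq_zero hB
      rw [Finset.subset_empty.1 (hp.1 B hB)]
      simpa using h0
    · rw [tSum_rec _ S k a ha, wNum,
        ← sum_blocks S a ha (fun j => w j * wNum w k (S.card - j))]
      apply Finset.sum_congr rfl
      intro B hB
      rw [ih, Finset.card_sdiff_of_subset (Finset.mem_powerset.1 (Finset.mem_filter.1 hB).1)]

lemma wNum_lt (w : ℕ → ℝ) (h1 : w 1 = 0) (k : ℕ) : ∀ s, s < 2 * k → wNum w k s = 0 := by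
  induction k with
  | zero => intro s hs; omega
  | succ k ih =>
    intro s hs
    rw [wNum]
    apply Finset.sum_eq_zero
    intro j hj
    rcases j with _ | j
    · simp [h1]
    · rw [ih _ (by have := Finset.mem_range.1 hj; omega)]; simp

lemma wNum_two (w : ℕ → ℝ) (h1 : w 1 = 0) (k : ℕ) :
    wNum w k (2*k) = (Nat.doubleFactorial (2*k-1) : ℝ) * w 2 ^ k := by
  induction k with
  | zero => simp [wNum]
  | succ k ih =>
    rw [wNum, Finset.sum_eq_single 1]
    · rw [show 2*(k+1) - (1+1) = 2*k by omega, ih, show 2*(k+1)-1 = 2*k+1 by omega]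
      have : Nat.doubleFactorial (2*k+1) = (2*k+1) * Nat.doubleFactorial (2*k-1) := by
        rcases k with _ | k
        · rfl
        · rw [show 2*(k+1)+1 = (2*k+1)+2 by ring, Nat.doubleFactorial_add_two]; congr 1
      rw [this]; push_cast; simp; ring
    · intro j hj hne
      rcases j with _ | _ | j
      · simp [h1]
      · omega
      · rw [wNum_lt w h1 k _ (by have := Finset.mem_range.1 hj; omega)]; simp
    · intro h; exact absurd (Finset.mem_range.2 (by omega)) h

lemma choose3 (m : ℕ) : ((m.choose 3 : ℕ) : ℝ) = (m:ℝ) * (m-1) * (m-2) / 6 := by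
  induction m with
  | zero => simp
  | succ m ih =>
    rw [Nat.choose_succ_succ' m 2]; push_cast; rw [ih, Nat.cast_choose_two]; ring

lemma wNum_three (w : ℕ → ℝ) (h1 : w 1 = 0) (k : ℕ) :
    wNum w k (2*k+1) = (Nat.choose (2*k+1) 3 : ℝ) * (Nat.doubleFactorial (2*k-3) : ℝ)
      * w 2 ^ (k-1) * w 3 := by
  induction k with
  | zero => simp [wNum, Nat.choose]
  | succ k ih =>
    rw [wNum, show 2*(k+1)+1 = (2*k)+1+1+1 by ring, Finset.sum_range_succ', Finset.sum_range_succ',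
      Finset.sum_range_succ', Finset.sum_eq_zero]
    · simp only [Nat.add_sub_cancel, zero_add, h1]
      rw [show 2*k+1+1+1-(1+1+1) = 2*k by omega, show 2*k+1+1+1-(1+1) = 2*k+1 by omega, ih,
        wNum_two w h1, choose3, choose3]
      simp only [show (1:ℕ)+1 = 2 from rfl, show (2:ℕ)+1 = 3 from rfl]
      rw [Nat.cast_choose_two, Nat.choose_one_right]
      rcases k with _ | k
      · simp; norm_num
      · have e : Nat.doubleFactorial (2*(k+1)-1) = (2*k+1) * Nat.doubleFactorial (2*(k+1)-3) := by
          rcases k with _ | k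
          · rfl
          · rw [show 2*(k+1+1)-1 = (2*k+1)+2 by omega, Nat.doubleFactorial_add_two]; congr 1
        rw [show 2*(k+1+1)-3 = 2*(k+1)-1 by omega, e]
        simp only [Nat.add_sub_cancel]
        push_cast
        ring
    · intro j hj
      rw [wNum_lt w h1 k _ (by have := Finset.mem_range.1 hj; omega)]; simp

theorem pSum_k_eq_n_sub_two (f g : ℝ → ℝ) (hf : ContDiff ℝ (⊤ : ℕ∞) f) (hg : ContDiff ℝ (⊤ : ℕ∞) g)
    (n : ℕ) (hn : 2 ≤ n) (t : ℝ) :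
    pSum f g n ((n : ℤ) - 2) t =
      (Nat.doubleFactorial (2 * n - 3) : ℝ) * iteratedDeriv 2 g t
          * (iteratedDeriv 2 f t) ^ (n - 2)
        + (Nat.choose (2 * n - 3) 3 : ℝ) * (Nat.doubleFactorial (2 * n - 7) : ℝ)
          * deriv g t * (iteratedDeriv 2 f t) ^ (n - 3) * iteratedDeriv 3 f t := by
  classical
  obtain ⟨k, rfl⟩ := Nat.exists_eq_add_of_le hn
  rw [show ((2 + k : ℕ) : ℤ) - 2 = (k : ℤ) by push_cast; ring]
  unfold pSum
  rw [if_neg (by omega)]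
  simp only [Int.toNat_natCast]
  set w : ℕ → ℝ := fun j => if j < 2 then 0 else iteratedDeriv j f t with hw
  let a : Fin (2 + k + k) := ⟨0, by omega⟩
  have hex : ∀ B : Finset (Fin (2+k+k)), (∃ x ∈ B, (x : ℕ) = 0) ↔ a ∈ B := by
    intro B
    constructor
    · rintro ⟨x, hx, h⟩
      have : x = a := Fin.ext h
      exact this ▸ hx
    · intro h; exact ⟨a, h, rfl⟩
  simp only [hex]
  let v : Finset (Fin (2+k+k)) → ℝ := fun B => if a ∈ B then iteratedDeriv B.card g t else w B.card
  trans tSum v Finset.univ (k+1)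
  · unfold tSum
    apply Finset.sum_subset_zero_on_sdiff
    · intro p hp
      simp only [Finset.mem_filter, Finset.mem_univ, true_and] at hp
      rw [mem_partsOf]
      exact ⟨fun B _ => Finset.subset_univ B, fun x _ => hp.2.1 x, hp.2.2.1⟩
    · intro p hp
      simp only [Finset.mem_sdiff, mem_partsOf, Finset.mem_filter, Finset.mem_univ, true_and] at hp
      obtain ⟨⟨-, h2, h3⟩, h4⟩ := hp
      by_contra hne
      rw [← ne_eq, Finset.prod_ne_zero_iff] at hne
      apply h4
      refine ⟨?_, fun x => h2 x trivial, h3, ?_⟩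
      · intro B hB
        by_contra h
        rw [Finset.not_nonempty_iff_eq_empty] at h
        apply hne B hB
        simp [v, hw, h]
      · intro B hB hc
        by_contra h
        apply hne B hB
        simp [v, hw, h, hc]
    · intro p hp
      simp only [Finset.mem_filter, Finset.mem_univ, true_and] at hp
      apply Finset.prod_congr rfl
      intro B hB
      have h1 := Finset.card_pos.2 (hp.1 B hB)
      have h2 := hp.2.2.2 B hB
      simp only [v, hw]
      split_ifs with ha hlt
      · rfl
      · exact absurd (h2 (by omega)) ha
      · rfl
  have h0 : w 0 = 0 := by simp [hw]
  have h1 : w 1 = 0 := by simp [hw]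
  rw [tSum_rec v _ k a (Finset.mem_univ a)]
  have hs := sum_blocks (Finset.univ : Finset (Fin (2+k+k))) a (Finset.mem_univ a)
    (fun j => iteratedDeriv j g t * wNum w k (2+k+k-j))
  refine Eq.trans (Finset.sum_congr rfl ?_) (hs.trans ?_)
  · intro B hB
    have haB := (Finset.mem_filter.1 hB).2
    rw [tSum_congr v (fun B => w B.card), tSum_card w h0,
      Finset.card_sdiff_of_subset (Finset.subset_univ B)]
    · simp [v, haB]
    · intro C hC
      have : a ∉ C := fun h => (Finset.mem_sdiff.1 (hC h)).2 haB
      simp [v, this]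
  rw [Finset.card_univ, Fintype.card_fin,
    show 2 + k + k = 2*k+1+1 by ring, Finset.sum_range_succ', Finset.sum_range_succ',
    Finset.sum_eq_zero]
  · simp only [Nat.add_sub_cancel, zero_add]
    rw [show 2*k+1+1-(1+1) = 2*k by omega, wNum_two w h1, wNum_three w h1,
      show 2*(2+k)-3 = 2*k+1 by omega, show 2*(2+k)-7 = 2*k-3 by omega,
      show 2+k-2 = k by omega, show 2+k-3 = k-1 by omega]
    have e : Nat.doubleFactorial (2*k+1) = (2*k+1) * Nat.doubleFactorial (2*k-1) := by
      rcases k with _ | k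
      · rfl
      · rw [show 2*(k+1)+1 = (2*k+1)+2 by ring, Nat.doubleFactorial_add_two]; congr 1
    have w2 : w 2 = iteratedDeriv 2 f t := by simp [hw]
    have w3 : w 3 = iteratedDeriv 3 f t := by simp [hw]
    rw [e, w2, w3, iteratedDeriv_one, Nat.choose_one_right, Nat.choose_zero_right]
    push_cast
    ring
  · intro j hj
    rw [wNum_lt w h1 k _ (by have := Finset.mem_range.1 hj; omega)]; simp
end
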